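/- arXiv:0801.4928 — 8 statements merged into one kernel-verified Lean document; each statement's English description precedes it below -/
import Mathlib

section
/- For every Young diagram λ, the number of X-diagrams of shape λ equals the number of Le-diagrams of shape λ. -/
/-- A diagram of shape `S`: a 0/1 filling (`Bool`-valued), required to be
`false` outside the cells of `S`. -/
def IsFilling (S : Finset (ℕ × ℕ)) (T : ℕ × ℕ → Bool) : Prop :=
  ∀ c, c ∉ S → T c = false

/-- `T` avoids the 2×2 pattern `[[a,b],[c,d]]` (top-left `a`, top-right `b`,
bottom-left `c`, bottom-right `d`) within the shape `S`. -/
def Avoids (S : Finset (ℕ × ℕ)) (T : ℕ × ℕ → Bool) (a b c d : Bool) : Prop :=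
  ¬ ∃ i i' j j' : ℕ, i < i' ∧ j < j' ∧
    (i, j) ∈ S ∧ (i, j') ∈ S ∧ (i', j) ∈ S ∧ (i', j') ∈ S ∧
    T (i, j) = a ∧ T (i, j') = b ∧ T (i', j) = c ∧ T (i', j') = d

/-- An X-diagram avoids the patterns `[[1,0],[0,1]]` and `[[0,1],[1,0]]`. -/
def IsXDiagram (S : Finset (ℕ × ℕ)) (T : ℕ × ℕ → Bool) : Prop :=
  IsFilling S T ∧ Avoids S T true false false true ∧ Avoids S T false true true false

/-- A Le-diagram avoids the patterns `[[1,1],[1,0]]` and `[[0,1],[1,0]]`. -/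
def IsLeDiagram (S : Finset (ℕ × ℕ)) (T : ℕ × ℕ → Bool) : Prop :=
  IsFilling S T ∧ Avoids S T true true true false ∧ Avoids S T false true true false

/-- Row `i` of the diagram is filled with 0s. -/
def ZeroRow (S : Finset (ℕ × ℕ)) (T : ℕ × ℕ → Bool) (i : ℕ) : Prop :=
  ∀ j, (i, j) ∈ S → T (i, j) = false

/-- Column `j` of the diagram is filled with 0s. -/
def ZeroCol (S : Finset (ℕ × ℕ)) (T : ℕ × ℕ → Bool) (j : ℕ) : Prop :=
  ∀ i, (i, j) ∈ S → T (i, j) = false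

/-- Cells of `S` outside row `p`. -/
def dropRow (S : Finset (ℕ × ℕ)) (p : ℕ) : Finset (ℕ × ℕ) := S.filter (fun c => c.1 ≠ p)

/-- Cells of `S` outside column `q`. -/
def dropCol (S : Finset (ℕ × ℕ)) (q : ℕ) : Finset (ℕ × ℕ) := S.filter (fun c => c.2 ≠ q)

theorem mem_dropRow (S : Finset (ℕ × ℕ)) (p i j : ℕ) :
    (i, j) ∈ dropRow S p ↔ (i, j) ∈ S ∧ i ≠ p := by simp [dropRow]

theorem mem_dropCol (S : Finset (ℕ × ℕ)) (q i j : ℕ) :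
    (i, j) ∈ dropCol S q ↔ (i, j) ∈ S ∧ j ≠ q := by simp [dropCol]

/-- Symmetric form of the X condition. -/
def NoCyc (S : Finset (ℕ × ℕ)) (T : ℕ × ℕ → Bool) : Prop :=
  ∀ i i' j j' : ℕ, (i, j) ∈ S → (i, j') ∈ S → (i', j) ∈ S → (i', j') ∈ S →
    T (i, j) = true → T (i, j') = false → T (i', j) = false → T (i', j') = true → False

def Fill (S : Finset (ℕ × ℕ)) (T : ℕ × ℕ → Bool) : Prop :=
  ∀ i j, T (i, j) = true → (i, j) ∈ S

def LeC (S : Finset (ℕ × ℕ)) (T : ℕ × ℕ → Bool) : Prop :=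
  ∀ i i' j j' : ℕ, i < i' → j < j' → (i, j) ∈ S → (i, j') ∈ S → (i', j) ∈ S → (i', j') ∈ S →
    T (i, j') = true → T (i', j) = true → T (i', j') = true

theorem isFilling_iff (S : Finset (ℕ × ℕ)) (T : ℕ × ℕ → Bool) : IsFilling S T ↔ Fill S T := by
  constructor
  · intro h i j hT
    by_contra hc
    simp [h _ hc] at hT
  · rintro h ⟨i, j⟩ hc
    by_contra hT
    exact hc (h i j (by simpa using hT))

theorem isX_iff (S : Finset (ℕ × ℕ)) (T : ℕ × ℕ → Bool) :
    IsXDiagram S T ↔ Fill S T ∧ NoCyc S T := by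
  unfold IsXDiagram
  rw [isFilling_iff]
  refine and_congr_right fun _ => ?_
  constructor
  · rintro ⟨h1, h2⟩ i i' j j' a b c d ha hb hc hd
    rcases lt_trichotomy i i' with hi | hi | hi
    · rcases lt_trichotomy j j' with hj | hj | hj
      · exact h1 ⟨i, i', j, j', hi, hj, a, b, c, d, ha, hb, hc, hd⟩
      · subst hj; simp_all
      · exact h2 ⟨i, i', j', j, hi, hj, b, a, d, c, hb, ha, hd, hc⟩
    · subst hi; simp_all
    · rcases lt_trichotomy j j' with hj | hj | hj
      · exact h2 ⟨i', i, j, j', hi, hj, c, d, a, b, hc, hd, ha, hb⟩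
      · subst hj; simp_all
      · exact h1 ⟨i', i, j', j, hi, hj, d, c, b, a, hd, hc, hb, ha⟩
  · intro h
    constructor
    · rintro ⟨i, i', j, j', hi, hj, a, b, c, d, ha, hb, hc, hd⟩
      exact h i i' j j' a b c d ha hb hc hd
    · rintro ⟨i, i', j, j', hi, hj, a, b, c, d, ha, hb, hc, hd⟩
      exact h i i' j' j b a d c hb ha hd hc

theorem isLe_iff (S : Finset (ℕ × ℕ)) (T : ℕ × ℕ → Bool) :
    IsLeDiagram S T ↔ Fill S T ∧ LeC S T := by
  unfold IsLeDiagram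
  rw [isFilling_iff]
  refine and_congr_right fun _ => ?_
  constructor
  · rintro ⟨h1, h2⟩ i i' j j' hi hj a b c d hb hc
    by_contra hd
    cases ha : T (i, j)
    · exact h2 ⟨i, i', j, j', hi, hj, a, b, c, d, ha, hb, hc, by simpa using hd⟩
    · exact h1 ⟨i, i', j, j', hi, hj, a, b, c, d, ha, hb, hc, by simpa using hd⟩
  · intro h
    constructor <;>
    · rintro ⟨i, i', j, j', hi, hj, a, b, c, d, ha, hb, hc, hd⟩
      have := h i i' j j' hi hj a b c d hb hc
      simp [hd] at this

def XS (S : Finset (ℕ × ℕ)) : Set (ℕ × ℕ → Bool) := {T | Fill S T ∧ NoCyc S T}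

def LS (S : Finset (ℕ × ℕ)) : Set (ℕ × ℕ → Bool) := {T | Fill S T ∧ LeC S T}

theorem fill_finite (S : Finset (ℕ × ℕ)) : {T | Fill S T}.Finite := by
  refine Set.Finite.of_finite_image (f := fun T => S.filter (fun c => T c = true)) ?_ ?_
  · refine Set.Finite.subset (Finset.finite_toSet S.powerset) ?_
    rintro _ ⟨T, _, rfl⟩
    exact Finset.mem_coe.2 (Finset.mem_powerset.2 (Finset.filter_subset _ _))
  · intro T hT T' hT' h
    funext ⟨i, j⟩
    have h' := congrArg (fun F => (i, j) ∈ F) h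
    simp only [Finset.mem_filter, eq_iff_iff] at h'
    have h1 := hT i j
    have h2 := hT' i j
    cases hx : T (i, j) <;> cases hy : T' (i, j) <;> simp_all

theorem XS_finite (S : Finset (ℕ × ℕ)) : (XS S).Finite :=
  (fill_finite S).subset fun _ h => h.1

theorem LS_finite (S : Finset (ℕ × ℕ)) : (LS S).Finite :=
  (fill_finite S).subset fun _ h => h.1

/-- T with value `v` at the cell `(p,q)`. -/
def setC (p q : ℕ) (v : Bool) (T : ℕ × ℕ → Bool) : ℕ × ℕ → Bool :=
  fun c => if c.1 = p ∧ c.2 = q then v else T c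

def clrRow (p : ℕ) (T : ℕ × ℕ → Bool) : ℕ × ℕ → Bool :=
  fun c => if c.1 = p then false else T c

def clrCol (q : ℕ) (T : ℕ × ℕ → Bool) : ℕ × ℕ → Bool :=
  fun c => if c.2 = q then false else T c

theorem mem_er (S : Finset (ℕ × ℕ)) (p q i j : ℕ) :
    (i, j) ∈ S.erase (p, q) ↔ (i, j) ∈ S ∧ ¬ (i = p ∧ j = q) := by
  simp [Finset.mem_erase, and_comm]

theorem ncard_bij {s t : Set (ℕ × ℕ → Bool)} (f g : (ℕ × ℕ → Bool) → (ℕ × ℕ → Bool))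
    (hf : ∀ x ∈ s, f x ∈ t) (hg : ∀ y ∈ t, g y ∈ s) (h1 : ∀ x ∈ s, g (f x) = x)
    (h2 : ∀ y ∈ t, f (g y) = y) : s.ncard = t.ncard := by
  refine Set.ncard_congr (fun x _ => f x) hf ?_ ?_
  · intro a b ha hb h
    rw [← h1 a ha, ← h1 b hb, h]
  · intro b hb
    exact ⟨g b, hg b hb, h2 b hb⟩

/-! ### Le side -/

theorem LS_zeroRow (S : Finset (ℕ × ℕ)) (p : ℕ) :
    {T ∈ LS S | ∀ j, T (p, j) = false} = LS (dropRow S p) := by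
  ext T
  simp only [LS, Fill, LeC, Set.mem_ofPred_eq, mem_dropRow]
  grind

theorem LS_zeroCol (S : Finset (ℕ × ℕ)) (q : ℕ) :
    {T ∈ LS S | ∀ i, T (i, q) = false} = LS (dropCol S q) := by
  ext T
  simp only [LS, Fill, LeC, Set.mem_ofPred_eq, mem_dropCol]
  grind

theorem LS_rec (S : Finset (ℕ × ℕ)) (p q : ℕ) (hpq : (p, q) ∈ S)
    (h : ∀ a b, (a, q) ∈ S → (p, b) ∈ S → (a, b) ∈ S)
    (hm : ∀ a b, (a, b) ∈ S → p ≤ a → q ≤ b → a = p ∧ b = q) :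
    (LS S).ncard + (LS (dropCol (dropRow S p) q)).ncard =
      (LS (S.erase (p, q))).ncard + (LS (dropRow S p)).ncard + (LS (dropCol S q)).ncard := by
  have e1 : ({T ∈ LS S | T (p, q) = true}).ncard = (LS (S.erase (p, q))).ncard := by
    refine ncard_bij (setC p q false) (setC p q true) ?_ ?_ ?_ ?_
    · rintro T ⟨⟨hF, hL⟩, hT⟩
      refine ⟨?_, ?_⟩
      · intro i j; simp only [setC, mem_er]; have := hF i j; grind
      · intro i i' j j'; simp only [setC, mem_er]; have := hL i i' j j'; grind
    · rintro T ⟨hF, hL⟩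
      refine ⟨⟨?_, ?_⟩, ?_⟩
      · intro i j; have := hF i j; simp only [setC, mem_er] at *; grind
      · intro i i' j j'; have := hL i i' j j'; simp only [setC, mem_er] at *
        have := hm i' j; have := hm i j'; have := hm i' j'; grind
      · simp [setC]
    · rintro T ⟨⟨hF, hL⟩, hT⟩
      funext ⟨i, j⟩; simp only [setC]; grind
    · rintro T ⟨hF, hL⟩
      have := hF p q
      funext ⟨i, j⟩; simp only [setC, mem_er] at *; grind
  have e2 : {T ∈ LS S | ¬ T (p, q) = true} = LS (dropRow S p) ∪ LS (dropCol S q) := by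
    rw [← LS_zeroRow, ← LS_zeroCol]
    ext T
    simp only [Set.mem_ofPred_eq, Set.mem_union]
    constructor
    · rintro ⟨hT, h0⟩
      by_contra hcon
      have hr : ∃ j, T (p, j) = true := by
        by_contra hh; push Not at hh; exact hcon (Or.inl ⟨hT, by simpa using hh⟩)
      have hc : ∃ i, T (i, q) = true := by
        by_contra hh; push Not at hh; exact hcon (Or.inr ⟨hT, by simpa using hh⟩)
      obtain ⟨j, hj⟩ := hr
      obtain ⟨i, hi⟩ := hc
      have hj' := hT.1 _ _ hj
      have hi' := hT.1 _ _ hi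
      have := hT.2 i p j q
      have := hm p j hj'
      have := hm i q hi'
      have := h i j hi' hj'
      grind
    · rintro (⟨hT, h0⟩ | ⟨hT, h0⟩)
      · exact ⟨hT, by simp [h0]⟩
      · exact ⟨hT, by simp [h0]⟩
  have e3 : LS (dropCol (dropRow S p) q) = LS (dropRow S p) ∩ LS (dropCol S q) := by
    rw [← LS_zeroCol, ← LS_zeroRow, ← LS_zeroCol]
    ext T
    simp only [Set.mem_ofPred_eq, Set.mem_inter_iff]
    tauto
  have e4 : LS S = {T ∈ LS S | T (p, q) = true} ∪ {T ∈ LS S | ¬ T (p, q) = true} := by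
    ext T; simp only [Set.mem_ofPred_eq, Set.mem_union]; tauto
  have e5 : (LS S).ncard = ({T ∈ LS S | T (p, q) = true}).ncard
      + ({T ∈ LS S | ¬ T (p, q) = true}).ncard := by
    conv_lhs => rw [e4]
    refine Set.ncard_union_eq ?_ ((LS_finite S).subset fun _ h => h.1)
      ((LS_finite S).subset fun _ h => h.1)
    rw [Set.disjoint_left]
    rintro T ⟨_, h1⟩ ⟨_, h2⟩
    exact h2 h1
  have e6 := Set.ncard_union_add_ncard_inter (LS (dropRow S p)) (LS (dropCol S q))
    (LS_finite _) (LS_finite _)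
  rw [e5, e1, e2, e3]
  omega

/-! ### X side -/

theorem XS_zeroRow (S : Finset (ℕ × ℕ)) (p : ℕ) :
    {T ∈ XS S | ∀ j, T (p, j) = false} = XS (dropRow S p) := by
  ext T
  simp only [XS, Fill, NoCyc, Set.mem_ofPred_eq, mem_dropRow]
  grind

/-- Fillings of `S` minus the corner which can be completed in both ways. -/
def Both (S : Finset (ℕ × ℕ)) (p q : ℕ) : Set (ℕ × ℕ → Bool) :=
  {T ∈ XS (S.erase (p, q)) | ∀ a b, (a, q) ∈ S → (p, b) ∈ S → a ≠ p → b ≠ q →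
    T (a, q) = T (p, b) → T (a, b) = T (a, q)}

theorem XS_ext (S : Finset (ℕ × ℕ)) (p q : ℕ) (hpq : (p, q) ∈ S)
    (h : ∀ a b, (a, q) ∈ S → (p, b) ∈ S → (a, b) ∈ S) :
    (XS S).ncard = (XS (S.erase (p, q))).ncard + (Both S p q).ncard := by
  have hv : ∀ v, ({T ∈ XS S | T (p, q) = v}).ncard =
      ({T ∈ XS (S.erase (p, q)) | ∀ a b, (a, q) ∈ S → (p, b) ∈ S → a ≠ p → b ≠ q →
        T (a, q) = T (p, b) → T (a, q) = !v → T (a, b) = T (a, q)}).ncard := by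
    intro v
    refine ncard_bij (setC p q false) (setC p q v) ?_ ?_ ?_ ?_
    · rintro T ⟨⟨hF, hL⟩, hT⟩
      refine ⟨⟨?_, ?_⟩, ?_⟩
      · intro i j; simp only [setC, mem_er]; have := hF i j; grind
      · intro i i' j j'; simp only [setC, mem_er]; have := hL i i' j j'; grind
      · intro a b ha hb hap hbq; simp only [setC]
        have := hL a p b q (h a b ha hb) ha hb hpq
        have := hL a p q b ha (h a b ha hb) hpq hb
        cases v <;> grind
    · rintro T ⟨⟨hF, hL⟩, hB⟩
      refine ⟨⟨?_, ?_⟩, ?_⟩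
      · intro i j; have := hF i j; simp only [setC, mem_er] at *; grind
      · intro i i' j j' m1 m2 m3 m4
        have := hL i i' j j'; simp only [setC, mem_er] at *
        have := hB i j; have := hB i j'; have := hB i' j; have := hB i' j'
        cases v <;> grind
      · simp [setC]
    · rintro T ⟨⟨hF, hL⟩, hT⟩
      funext ⟨i, j⟩; simp only [setC]; grind
    · rintro T ⟨⟨hF, hL⟩, hB⟩
      have := hF p q
      funext ⟨i, j⟩; simp only [setC, mem_er] at *; grind
  have e4 : XS S = {T ∈ XS S | T (p, q) = true} ∪ {T ∈ XS S | T (p, q) = false} := by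
    ext T; simp only [Set.mem_ofPred_eq, Set.mem_union]
    cases T (p, q) <;> simp
  have e5 : (XS S).ncard = ({T ∈ XS S | T (p, q) = true}).ncard
      + ({T ∈ XS S | T (p, q) = false}).ncard := by
    conv_lhs => rw [e4]
    refine Set.ncard_union_eq ?_ ((XS_finite S).subset fun _ h => h.1)
      ((XS_finite S).subset fun _ h => h.1)
    rw [Set.disjoint_left]
    rintro T ⟨_, h1⟩ ⟨_, h2⟩
    simp [h1] at h2
  rw [e5, hv, hv, ← Set.ncard_union_add_ncard_inter _ _
    ((XS_finite _).subset fun _ h => h.1) ((XS_finite _).subset fun _ h => h.1)]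
  congr 2
  · ext T
    simp only [Set.mem_ofPred_eq, Set.mem_union]
    constructor
    · rintro (h | h) <;> exact h.1
    · intro hT
      by_contra hcon
      have h1 : ¬ _ := fun hh => hcon (Or.inl ⟨hT, hh⟩)
      have h2 : ¬ _ := fun hh => hcon (Or.inr ⟨hT, hh⟩)
      push Not at h1 h2
      obtain ⟨a, b, ha, hb, hap, hbq, u1, u2, u3⟩ := h1
      obtain ⟨a', b', ha', hb', hap', hbq', u1', u2', u3'⟩ := h2
      have hL := hT.2
      have := h a b ha hb
      have := h a b' ha hb'
      have := h a' b ha' hb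
      have := h a' b' ha' hb'
      have k1 := hL a a' b' q
      have k2 := hL p a b' b
      simp only [mem_er] at k1 k2
      cases hx : T (a, b') <;> grind
  · ext T
    simp only [Both, Set.mem_ofPred_eq, Set.mem_inter_iff]
    constructor
    · rintro ⟨⟨h1, h2⟩, _, h3⟩
      refine ⟨h1, fun a b ha hb hap hbq e => ?_⟩
      cases hx : T (a, q)
      · rw [h2 a b ha hb hap hbq e (by simp [hx]), hx]
      · rw [h3 a b ha hb hap hbq e (by simp [hx]), hx]
    · rintro ⟨h1, h2⟩
      exact ⟨⟨h1, fun a b ha hb hap hbq e _ => h2 a b ha hb hap hbq e⟩,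
        h1, fun a b ha hb hap hbq e _ => h2 a b ha hb hap hbq e⟩

/-- Column `b` lies above some row which is above the new vertex. -/
def UpC (S : Finset (ℕ × ℕ)) (p q : ℕ) (T : ℕ × ℕ → Bool) (b : ℕ) : Prop :=
  ∃ a, (a, q) ∈ S ∧ a ≠ p ∧ T (a, q) = false ∧ T (a, b) = true

def UpR (q p : ℕ) (T : ℕ × ℕ → Bool) (a : ℕ) : Prop :=
  ∃ b, b ≠ q ∧ T (p, b) = true ∧ T (a, b) = false

open Classical in
noncomputable def fillRow (S : Finset (ℕ × ℕ)) (p q : ℕ) (T : ℕ × ℕ → Bool) : ℕ × ℕ → Bool :=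
  fun c => if c.1 = p then decide ((p, c.2) ∈ S ∧ c.2 ≠ q ∧ UpC S p q T c.2) else T c

open Classical in
noncomputable def fillCol (S : Finset (ℕ × ℕ)) (p q : ℕ) (T : ℕ × ℕ → Bool) : ℕ × ℕ → Bool :=
  fun c => if c.2 = q then decide ((c.1, q) ∈ S ∧ c.1 ≠ p ∧ ¬ UpR q p T c.1) else T c

/-- The row part of a doubly extendable filling is generated by the column part. -/
def PP (S : Finset (ℕ × ℕ)) (p q : ℕ) (T : ℕ × ℕ → Bool) : Prop :=
  ∀ b, (p, b) ∈ S → b ≠ q → (T (p, b) = true ↔ UpC S p q T b)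

theorem both_P (S : Finset (ℕ × ℕ)) (p q : ℕ) (hpq : (p, q) ∈ S)
    (h : ∀ a b, (a, q) ∈ S → (p, b) ∈ S → (a, b) ∈ S) :
    ({T ∈ Both S p q | PP S p q T}).ncard = (XS (dropRow S p)).ncard := by
  refine ncard_bij (clrRow p) (fillRow S p q) ?_ ?_ ?_ ?_
  · rintro T ⟨⟨⟨hF, hL⟩, hB⟩, hP⟩
    refine ⟨?_, ?_⟩
    · intro i j; simp only [clrRow, mem_dropRow]; have := hF i j; simp only [mem_er] at this; grind
    · intro i i' j j'; simp only [clrRow, mem_dropRow]; have := hL i i' j j'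
      simp only [mem_er] at this; grind
  · rintro T ⟨hF, hL⟩
    have key : ∀ i j j', i ≠ p → (p, j) ∈ S → (p, j') ∈ S → (i, j) ∈ S → (i, j') ∈ S → j ≠ q →
        j' ≠ q → UpC S p q T j → ¬ UpC S p q T j' → T (i, j) = false → T (i, j') = true →
        False := by
      rintro i j j' hip mj mj' mi mi' hj hj' ⟨a, ha, hap, ha1, ha2⟩ hn t1 t2
      have haj : T (a, j') = false := by
        by_contra hx
        exact hn ⟨a, ha, hap, ha1, by simpa using hx⟩
      have := hL a i j j'
      simp only [mem_dropRow] at this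
      exact this ⟨h _ _ ha mj, hap⟩ ⟨h _ _ ha mj', hap⟩ ⟨mi, hip⟩ ⟨mi', hip⟩ ha2 haj t1 t2
    refine ⟨⟨⟨?_, ?_⟩, ?_⟩, ?_⟩
    · intro i j; have := hF i j
      simp only [fillRow, mem_dropRow, mem_er] at *
      split_ifs with hi
      · subst hi; simp only [decide_eq_true_eq]; tauto
      · intro ht; exact ⟨(this ht).1, fun hh => hi hh.1⟩
    · intro i i' j j'; have := hL i i' j j'
      have k1 := key i j' j
      have k2 := key i' j j'
      simp only [fillRow, mem_dropRow, mem_er] at *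
      intro m1 m2 m3 m4
      split_ifs with h1 h2 h2
      · subst h1; subst h2; grind
      · subst h1; simp only [decide_eq_true_eq, decide_eq_false_iff_not]; grind
      · subst h2; simp only [decide_eq_true_eq, decide_eq_false_iff_not]; grind
      · grind
    · intro a b ha hb hap hbq
      simp only [fillRow, hap, if_false, if_true, hb, true_and]
      cases hx : T (a, q)
      · intro hu
        have hu' : ¬ UpC S p q T b := by
          intro hc; have := hu.symm; simp [hc, hbq, hb] at this
        by_contra hy
        exact hu' ⟨a, ha, hap, hx, by simpa using hy⟩
      · intro hu
        have hu' : UpC S p q T b := by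
          have := hu.symm; simp at this; exact this.2.2
        obtain ⟨a', ha', hap', u1, u2⟩ := hu'
        by_contra hy
        have := hL a' a b q
        simp only [mem_dropRow] at this
        exact this ⟨h _ _ ha' hb, hap'⟩ ⟨ha', hap'⟩ ⟨h _ _ ha hb, hap⟩ ⟨ha, hap⟩ u2 u1
          (by simpa using hy) hx
    · intro b hb hbq
      have : UpC S p q (fillRow S p q T) b ↔ UpC S p q T b := by
        unfold UpC fillRow
        refine exists_congr fun a => ?_
        simp only []
        by_cases hap : a = p <;> simp [hap]
      rw [this]
      simp [fillRow, hb, hbq]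
  · rintro T ⟨⟨⟨hF, hL⟩, hB⟩, hP⟩
    have hup : ∀ b, UpC S p q (clrRow p T) b ↔ UpC S p q T b := by
      intro b
      unfold UpC clrRow
      refine exists_congr fun a => ?_
      simp only []
      by_cases hap : a = p <;> simp [hap]
    funext ⟨i, j⟩
    simp only [fillRow]
    split_ifs with hi
    · subst hi
      rw [Bool.eq_iff_iff]
      simp only [decide_eq_true_eq, hup]
      have := hP j
      have hf := hF i j
      simp only [mem_er] at hf
      by_cases hc : (i, j) ∈ S ∧ j ≠ q
      · have := this hc.1 hc.2
        tauto
      · constructor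
        · tauto
        · intro hx
          have := hf hx; simp at this; tauto
    · simp [clrRow, hi]
  · rintro T ⟨hF, hL⟩
    funext ⟨i, j⟩
    have hf := hF i j
    simp only [mem_dropRow] at hf
    simp only [clrRow, fillRow]
    grind

theorem both_Q (S : Finset (ℕ × ℕ)) (p q : ℕ) (hpq : (p, q) ∈ S)
    (h : ∀ a b, (a, q) ∈ S → (p, b) ∈ S → (a, b) ∈ S) :
    ({T ∈ Both S p q | ¬ PP S p q T}).ncard =
      ({T ∈ XS (dropCol S q) | ¬ ∀ j, T (p, j) = false}).ncard := by
  have hQ : ∀ T ∈ Both S p q, ¬ PP S p q T →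
      ∃ b, (p, b) ∈ S ∧ b ≠ q ∧ T (p, b) = true ∧ ¬ UpC S p q T b := by
    rintro T ⟨⟨hF, hL⟩, hB⟩ hP
    by_contra hcon
    push Not at hcon
    apply hP
    intro b hb hbq
    refine ⟨hcon b hb hbq, ?_⟩
    rintro ⟨a, ha, hap, h1, h2⟩
    have := hB a b ha hb hap hbq
    grind
  refine ncard_bij (clrCol q) (fillCol S p q) ?_ ?_ ?_ ?_
  · rintro T ⟨hTB, hP⟩
    obtain ⟨b, hb, hbq, hb1, -⟩ := hQ T hTB hP
    obtain ⟨⟨hF, hL⟩, hB⟩ := hTB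
    refine ⟨⟨?_, ?_⟩, ?_⟩
    · intro i j; simp only [clrCol, mem_dropCol]; have := hF i j; simp only [mem_er] at this; grind
    · intro i i' j j'; simp only [clrCol, mem_dropCol]; have := hL i i' j j'
      simp only [mem_er] at this; grind
    · intro hh
      have := hh b
      simp [clrCol, hbq, hb1] at this
  · rintro T ⟨⟨hF, hL⟩, hZ⟩
    have hT : ∀ i j, T (i, j) = true → (i, j) ∈ S ∧ j ≠ q := by
      intro i j ht; have := hF i j ht; rwa [mem_dropCol] at this
    have hL' : ∀ i i' j j' : ℕ, (i, j) ∈ S → (i, j') ∈ S → (i', j) ∈ S → (i', j') ∈ S →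
        j ≠ q → j' ≠ q →
        T (i, j) = true → T (i, j') = false → T (i', j) = false → T (i', j') = true → False := by
      intro i i' j j' a b c d e f
      have := hL i i' j j'
      simp only [mem_dropCol] at this
      exact this ⟨a, e⟩ ⟨b, f⟩ ⟨c, e⟩ ⟨d, f⟩
    -- two rows meeting column q, and a common column j
    have key : ∀ i i' j, (i, q) ∈ S → (i', q) ∈ S → (i, j) ∈ S → (i', j) ∈ S → j ≠ q →
        UpR q p T i → ¬ UpR q p T i' → T (i, j) = true → T (i', j) = false → False := by
      rintro i i' j mi mi' m m' hj ⟨b, hbq, u1, u2⟩ hn t1 t2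
      have hbS := (hT _ _ u1).1
      have hb' : T (i', b) = true := by
        by_contra hx
        exact hn ⟨b, hbq, u1, by simpa using hx⟩
      exact hL' i i' j b m (h _ _ mi hbS) m' (h _ _ mi' hbS) hj hbq t1 u2 t2 hb'
    refine ⟨⟨⟨?_, ?_⟩, ?_⟩, ?_⟩
    · intro i j
      simp only [fillCol, mem_er]
      split_ifs with hj
      · subst hj; simp only [decide_eq_true_eq]; tauto
      · intro ht; exact ⟨(hT _ _ ht).1, fun hh => hj hh.2⟩
    · intro i i' j j'
      have := hL' i i' j j'
      have k1 := key i' i j'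
      have k2 := key i i' j
      simp only [fillCol, mem_er] at *
      intro m1 m2 m3 m4
      split_ifs with h1 h2 h2
      · subst h1; subst h2; grind
      · subst h1; simp only [decide_eq_true_eq, decide_eq_false_iff_not]; grind
      · subst h2; simp only [decide_eq_true_eq, decide_eq_false_iff_not]; grind
      · grind
    · intro a b ha hb hap hbq
      simp only [fillCol, hbq, if_false, if_true, ha, hap, true_and]
      intro hu
      rw [hu]
      cases hx : T (p, b)
      · have hu' : UpR q p T a := by
          by_contra hc; simp [hc, hap, hx, ha] at hu
        obtain ⟨b', hbq', u1, u2⟩ := hu'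
        have hb' := (hT _ _ u1).1
        by_contra hy
        exact hL' a p b b' (h _ _ ha hb) (h _ _ ha hb') hb hb' hbq hbq' (by simpa using hy)
          u2 hx u1
      · have hu' : ¬ UpR q p T a := by
          intro hc; simp [hc, hx] at hu
        by_contra hy
        exact hu' ⟨b, hbq, hx, by simpa using hy⟩
    · intro hP
      have hup : ∀ b, b ≠ q → (p, b) ∈ S → T (p, b) = true →
          ∃ a, (a, q) ∈ S ∧ a ≠ p ∧ UpR q p T a ∧ T (a, b) = true := by
        intro b hbq hb ht
        have h1 := (hP b hb hbq).1 (by simp [fillCol, hbq, ht])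
        obtain ⟨a, ha, hap, u1, u2⟩ := h1
        refine ⟨a, ha, hap, ?_, ?_⟩
        · by_contra hc; simp [fillCol, ha, hap, hc] at u1
        · simpa [fillCol, hbq] using u2
      classical
      let Z : Finset ℕ := (S.image Prod.snd).filter (fun b => T (p, b) = true)
      have hZne : Z.Nonempty := by
        push Not at hZ
        obtain ⟨j, hj⟩ := hZ
        have hj : T (p, j) = true := by simpa using hj
        refine ⟨j, ?_⟩
        simp only [Z, Finset.mem_filter, Finset.mem_image]
        exact ⟨⟨(p, j), (hT _ _ hj).1, rfl⟩, hj⟩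
      let A : Finset ℕ := (S.image Prod.fst).filter (fun a => (a, q) ∈ S)
      -- minimise the number of incoming rows
      obtain ⟨b, hbZ, hmin⟩ := Finset.exists_min_image Z
        (fun b => (A.filter (fun a => T (a, b) = true)).card) hZne
      have hb1 : T (p, b) = true := (Finset.mem_filter.1 hbZ).2
      obtain ⟨hb, hbq⟩ := hT _ _ hb1
      obtain ⟨a, ha, hap, ⟨b', hbq', v1, v2⟩, hab⟩ := hup b hbq hb hb1
      have hb' := (hT _ _ v1).1
      have hb'Z : b' ∈ Z := by
        simp only [Z, Finset.mem_filter, Finset.mem_image]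
        exact ⟨⟨(p, b'), hb', rfl⟩, v1⟩
      have hlt : (A.filter (fun a => T (a, b') = true)).card
          < (A.filter (fun a => T (a, b) = true)).card := by
        apply Finset.card_lt_card
        rw [Finset.ssubset_iff_of_subset]
        · refine ⟨a, ?_, ?_⟩
          · simp only [A, Finset.mem_filter, Finset.mem_image]
            exact ⟨⟨⟨(a, q), ha, rfl⟩, ha⟩, hab⟩
          · simp [v2]
        · intro x hx
          simp only [A, Finset.mem_filter] at hx ⊢
          refine ⟨hx.1, ?_⟩
          by_contra hy
          exact hL' a x b b' (h _ _ ha hb) (h _ _ ha hb') (h _ _ hx.1.2 hb) (h _ _ hx.1.2 hb')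
            hbq hbq' hab v2 (by simpa using hy) hx.2
      have := hmin b' hb'Z
      omega
  · rintro T ⟨hTB, hP⟩
    obtain ⟨b, hb, hbq, hb1, hb2⟩ := hQ T hTB hP
    obtain ⟨⟨hF, hL⟩, hB⟩ := hTB
    have hup : ∀ a, UpR q p (clrCol q T) a ↔ UpR q p T a := by
      intro a
      unfold UpR clrCol
      refine exists_congr fun b => ?_
      simp only []
      by_cases hbq : b = q <;> simp [hbq]
    funext ⟨i, j⟩
    simp only [fillCol]
    split_ifs with hj
    · subst hj
      have hf := hF i j
      simp only [mem_er] at hf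
      cases hx : T (i, j)
      · simp only [decide_eq_false_iff_not]
        rintro ⟨hi, hip, hn⟩
        apply hn
        rw [hup]
        refine ⟨b, hbq, hb1, ?_⟩
        by_contra hy
        exact hb2 ⟨i, hi, hip, hx, by simpa using hy⟩
      · simp only [decide_eq_true_eq]
        have hh := hf hx
        have hip : i ≠ p := fun e => hh.2 (by simp [e])
        refine ⟨hh.1, hip, ?_⟩
        rw [hup]
        rintro ⟨b', hbq', u1, u2⟩
        have hb' := hF _ _ u1
        rw [mem_er] at hb'
        have := hB i b' hh.1 hb'.1 hip hbq'
        grind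
    · simp [clrCol, hj]
  · rintro T ⟨⟨hF, hL⟩, hZ⟩
    funext ⟨i, j⟩
    have hf := hF i j
    simp only [mem_dropCol] at hf
    simp only [clrCol, fillCol]
    grind

theorem ncard_split {s : Set (ℕ × ℕ → Bool)} (hs : s.Finite) (P : (ℕ × ℕ → Bool) → Prop) :
    s.ncard = ({T ∈ s | P T}).ncard + ({T ∈ s | ¬ P T}).ncard := by
  have e4 : s = {T ∈ s | P T} ∪ {T ∈ s | ¬ P T} := by
    ext T; simp only [Set.mem_ofPred_eq, Set.mem_union]; tauto
  conv_lhs => rw [e4]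
  refine Set.ncard_union_eq ?_ (hs.subset fun _ h => h.1) (hs.subset fun _ h => h.1)
  rw [Set.disjoint_left]
  rintro T ⟨_, h1⟩ ⟨_, h2⟩
  exact h2 h1

theorem drop_comm (S : Finset (ℕ × ℕ)) (p q : ℕ) :
    dropRow (dropCol S q) p = dropCol (dropRow S p) q := by
  ext ⟨i, j⟩
  simp only [mem_dropRow, mem_dropCol]; tauto

theorem XS_rec (S : Finset (ℕ × ℕ)) (p q : ℕ) (hpq : (p, q) ∈ S)
    (h : ∀ a b, (a, q) ∈ S → (p, b) ∈ S → (a, b) ∈ S) :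
    (XS S).ncard + (XS (dropCol (dropRow S p) q)).ncard =
      (XS (S.erase (p, q))).ncard + (XS (dropRow S p)).ncard + (XS (dropCol S q)).ncard := by
  have h1 := XS_ext S p q hpq h
  have h2 := ncard_split (s := Both S p q) ((XS_finite _).subset fun _ h => h.1) (PP S p q)
  rw [both_P S p q hpq h, both_Q S p q hpq h] at h2
  have h3 := ncard_split (XS_finite (dropCol S q)) (fun T => ∀ j, T (p, j) = false)
  rw [XS_zeroRow, drop_comm] at h3
  omega

/-- Ferrers shapes up to insertion of empty rows and columns. -/
def Fer (S : Finset (ℕ × ℕ)) : Prop :=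
  ∀ i i' j j' k l, i ≤ i' → j ≤ j' → (i', j') ∈ S → (i, k) ∈ S → (l, j) ∈ S → (i, j) ∈ S

theorem main_count : ∀ n (S : Finset (ℕ × ℕ)), S.card ≤ n → Fer S →
    (XS S).ncard = (LS S).ncard := by
  intro n
  induction n with
  | zero =>
    intro S hS _
    have : S = ∅ := Finset.card_eq_zero.1 (by omega)
    subst this
    congr 1
    ext T
    simp [XS, LS, NoCyc, LeC]
  | succ n ih =>
    intro S hS hFer
    by_cases hne : S.Nonempty
    · obtain ⟨⟨p, q⟩, hmax⟩ := S.exists_maximal hne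
      have hpq : (p, q) ∈ S := hmax.1
      have hm : ∀ a b, (a, b) ∈ S → p ≤ a → q ≤ b → a = p ∧ b = q := by
        intro a b hab h1 h2
        have := hmax.2 hab (show (p, q) ≤ (a, b) from ⟨h1, h2⟩)
        have h3 : a ≤ p := this.1
        have h4 : b ≤ q := this.2
        omega
      have h : ∀ a b, (a, q) ∈ S → (p, b) ∈ S → (a, b) ∈ S := by
        intro a b ha hb
        have h1 : a ≤ p := by
          by_contra hc; have := hm a q ha (by omega) le_rfl; omega
        have h2 : b ≤ q := by
          by_contra hc; have := hm p b hb le_rfl (by omega); omega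
        exact hFer a p b q q p h1 h2 hpq ha hb
      have r1 := XS_rec S p q hpq h
      have r2 := LS_rec S p q hpq h hm
      have small : ∀ S' : Finset (ℕ × ℕ), S' ⊆ S → (p, q) ∉ S' → S'.card ≤ n := by
        intro S' hs hn
        have : S'.card < S.card := Finset.card_lt_card
          ((Finset.ssubset_iff_of_subset hs).2 ⟨_, hpq, hn⟩)
        omega
      have i1 := ih (S.erase (p, q)) (small _ (Finset.erase_subset _ _) (by simp)) (by
        intro i i' j j' k l hi hj m1 m2 m3
        rw [mem_er] at *
        refine ⟨hFer i i' j j' k l hi hj m1.1 m2.1 m3.1, ?_⟩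
        rintro ⟨rfl, rfl⟩
        exact m1.2 (hm _ _ m1.1 hi hj))
      have fR : ∀ S', Fer S' → Fer (dropRow S' p) := by
        intro S' hF i i' j j' k l hi hj m1 m2 m3
        rw [mem_dropRow] at *
        exact ⟨hF i i' j j' k l hi hj m1.1 m2.1 m3.1, m2.2⟩
      have fC : ∀ S', Fer S' → Fer (dropCol S' q) := by
        intro S' hF i i' j j' k l hi hj m1 m2 m3
        rw [mem_dropCol] at *
        exact ⟨hF i i' j j' k l hi hj m1.1 m2.1 m3.1, m3.2⟩
      have i2 := ih (dropRow S p) (small _ (Finset.filter_subset _ _) (by simp [mem_dropRow]))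
        (fR _ hFer)
      have i3 := ih (dropCol S q) (small _ (Finset.filter_subset _ _) (by simp [mem_dropCol]))
        (fC _ hFer)
      have i4 := ih (dropCol (dropRow S p) q)
        (small _ ((Finset.filter_subset _ _).trans (Finset.filter_subset _ _))
          (by simp [mem_dropCol])) (fC _ (fR _ hFer))
      omega
    · rw [Finset.not_nonempty_iff_eq_empty] at hne
      exact ih S (by simp [hne]) hFer

/-- for every Young diagram, the number of X-diagrams of that
shape equals the number of Le-diagrams of that shape. -/
theorem stmt0 (μ : YoungDiagram) :
    {T : ℕ × ℕ → Bool | IsXDiagram μ.cells T}.ncard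
      = {T : ℕ × ℕ → Bool | IsLeDiagram μ.cells T}.ncard := by
  simp only [isX_iff, isLe_iff]
  refine main_count _ μ.cells le_rfl ?_
  intro i i' j j' k l hi hj m _ _
  exact μ.isLowerSet (show (i, j) ≤ (i', j') from ⟨hi, hj⟩) m
end

section
/- For every Young diagram λ there exists a bijection Φ from the set of X-diagrams of shape λ onto the set of Le-diagrams of shape λ such that for every X-diagram T, the diagrams T and Φ(T) have the same set of zero-rows and the same set of zero-columns. -/
namespace XLe

abbrev F := Finset (ℕ × ℕ)

def XOK (S T : F) : Prop := ∀ i i' j j', (i,j) ∈ S → (i,j') ∈ S → (i',j) ∈ S → (i',j') ∈ S →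
  (i,j) ∈ T → (i',j') ∈ T → (i,j') ∈ T ∨ (i',j) ∈ T

def LOK (S T : F) : Prop := ∀ i i' j j', i < i' → j < j' →
  (i,j) ∈ S → (i,j') ∈ S → (i',j) ∈ S → (i',j') ∈ S →
  (i,j') ∈ T → (i',j) ∈ T → (i',j') ∈ T

open Classical in
noncomputable def XS (S : F) : Finset F := S.powerset.filter (XOK S)
open Classical in
noncomputable def LS (S : F) : Finset F := S.powerset.filter (LOK S)

lemma mem_XS {S T : F} : T ∈ XS S ↔ T ⊆ S ∧ XOK S T := by simp [XS]
lemma mem_LS {S T : F} : T ∈ LS S ↔ T ⊆ S ∧ LOK S T := by simp [LS]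

def dr (S : F) (r : ℕ) : F := S.filter (fun p => p.1 ≠ r)
def dc (S : F) (c : ℕ) : F := S.filter (fun p => p.2 ≠ c)

lemma mem_dr {S : F} {r : ℕ} {p : ℕ × ℕ} : p ∈ dr S r ↔ p ∈ S ∧ p.1 ≠ r := by simp [dr]
lemma mem_dc {S : F} {r : ℕ} {p : ℕ × ℕ} : p ∈ dc S r ↔ p ∈ S ∧ p.2 ≠ r := by simp [dc]

/-- corner hypotheses -/
structure Corner (S : F) (r c : ℕ) : Prop where
  mem : (r,c) ∈ S
  row : ∀ j, (r,j) ∈ S → j ≤ c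
  col : ∀ i, (i,c) ∈ S → i ≤ r
  rect : ∀ i j, (i,c) ∈ S → (r,j) ∈ S → (i,j) ∈ S

lemma LS_rec {S : F} {r c : ℕ} (h : Corner S r c) :
    (LS S).card + (LS (dc (dr S r) c)).card
      = (LS (S.erase (r,c))).card + (LS (dr S r)).card + (LS (dc S c)).card := by
  classical
  have h1 : ((LS S).filter (fun T => (r,c) ∈ T)).card = (LS (S.erase (r,c))).card := by
    apply Finset.card_nbij' (fun T => T.erase (r,c)) (fun T => insert (r,c) T)
    · intro T hT
      simp only [Finset.coe_filter, Set.mem_ofPred_eq, mem_LS, SetLike.mem_coe] at hT ⊢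
      obtain ⟨⟨hs, hl⟩, hx⟩ := hT
      refine ⟨Finset.erase_subset_erase _ hs, ?_⟩
      intro i i' j j' hi hj
      have := hl i i' j j' hi hj
      grind
    · intro T hT
      simp only [Finset.coe_filter, Set.mem_ofPred_eq, mem_LS, SetLike.mem_coe] at hT ⊢
      obtain ⟨hs, hl⟩ := hT
      have hm := h.mem
      refine ⟨⟨by grind, ?_⟩, by simp⟩
      intro i i' j j' hi hj a b d e f g
      have h2 := hl i i' j j' hi hj
      have h3 := h.row j'
      have h4 := h.col i'
      have h5 := h.row j
      have h6 := h.col i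
      grind
    · intro T hT
      have : (r,c) ∈ T := by simpa using (Finset.mem_filter.1 hT).2
      simp [Finset.insert_erase this]
    · intro T hT
      have := (mem_LS.1 hT).1
      have : (r,c) ∉ T := fun hh => by simpa using this hh
      simp [this]
  have h2 : (LS S).filter (fun T => (r,c) ∉ T) = LS (dr S r) ∪ LS (dc S c) := by
    ext T
    simp only [Finset.mem_filter, Finset.mem_union, mem_LS]
    constructor
    · rintro ⟨⟨hs, hl⟩, hx⟩
      by_cases hr : ∃ j, (r,j) ∈ T
      · right
        obtain ⟨j, hj⟩ := hr
        have hjc := h.row j (hs hj)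
        have hjc' : j < c := lt_of_le_of_ne hjc (by rintro rfl; exact hx hj)
        refine ⟨?_, ?_⟩
        · rintro ⟨i, j'⟩ hp
          refine mem_dc.2 ⟨hs hp, ?_⟩
          rintro rfl
          have hir := h.col i (hs hp)
          have hir' : i < r := lt_of_le_of_ne hir (by rintro rfl; exact hx hp)
          exact hx (hl i r j _ hir' hjc' (h.rect _ _ (hs hp) (hs hj)) (hs hp) (hs hj) h.mem hp hj)
        · intro i i' j j' hi hj a b d e
          exact hl i i' j j' hi hj (mem_dc.1 a).1 (mem_dc.1 b).1 (mem_dc.1 d).1 (mem_dc.1 e).1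
      · left
        refine ⟨?_, ?_⟩
        · rintro ⟨i, j'⟩ hp
          refine mem_dr.2 ⟨hs hp, ?_⟩
          rintro rfl
          exact hr ⟨_, hp⟩
        · intro i i' j j' hi hj a b d e
          exact hl i i' j j' hi hj (mem_dr.1 a).1 (mem_dr.1 b).1 (mem_dr.1 d).1 (mem_dr.1 e).1
    · rintro (⟨hs, hl⟩ | ⟨hs, hl⟩)
      · refine ⟨⟨fun p hp => (mem_dr.1 (hs hp)).1, ?_⟩, fun hh => by simpa [mem_dr] using hs hh⟩
        intro i i' j j' hi hj a b d e f g
        have h1 := mem_dr.1 (hs f)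
        have h2 := mem_dr.1 (hs g)
        exact hl i i' j j' hi hj (mem_dr.2 ⟨a, h1.2⟩) (mem_dr.2 ⟨b, h1.2⟩) (mem_dr.2 ⟨d, h2.2⟩)
          (mem_dr.2 ⟨e, h2.2⟩) f g
      · refine ⟨⟨fun p hp => (mem_dc.1 (hs hp)).1, ?_⟩, fun hh => by simpa [mem_dc] using hs hh⟩
        intro i i' j j' hi hj a b d e f g
        have h1 := mem_dc.1 (hs f)
        have h2 := mem_dc.1 (hs g)
        exact hl i i' j j' hi hj (mem_dc.2 ⟨a, h2.2⟩) (mem_dc.2 ⟨b, h1.2⟩) (mem_dc.2 ⟨d, h2.2⟩)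
          (mem_dc.2 ⟨e, h1.2⟩) f g
  have h3 : LS (dr S r) ∩ LS (dc S c) = LS (dc (dr S r) c) := by
    ext T
    simp only [Finset.mem_inter, mem_LS]
    constructor
    · rintro ⟨⟨hs, hl⟩, ⟨hs', hl'⟩⟩
      refine ⟨fun p hp => mem_dc.2 ⟨hs hp, (mem_dc.1 (hs' hp)).2⟩, ?_⟩
      intro i i' j j' hi hj a b d e
      exact hl i i' j j' hi hj (mem_dc.1 a).1 (mem_dc.1 b).1 (mem_dc.1 d).1 (mem_dc.1 e).1
    · rintro ⟨hs, hl⟩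
      have hT : ∀ i j, (i,j) ∈ T → (i,j) ∈ S ∧ i ≠ r ∧ j ≠ c := by
        intro i j hp
        have := hs hp
        simp only [mem_dr, mem_dc] at this
        tauto
      refine ⟨⟨fun p hp => mem_dr.2 ⟨(hT _ _ hp).1, (hT _ _ hp).2.1⟩, ?_⟩,
        ⟨fun p hp => mem_dc.2 ⟨(hT _ _ hp).1, (hT _ _ hp).2.2⟩, ?_⟩⟩ <;>
      · intro i i' j j' hi hj a b d e f g
        have h1 := hT _ _ f
        have h2 := hT _ _ g
        have h3 := hl i i' j j' hi hj
        simp only [mem_dr, mem_dc] at *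
        tauto
  have h4 := Finset.card_union_add_card_inter (LS (dr S r)) (LS (dc S c))
  have h5 := Finset.card_filter_add_card_filter_not (s := LS S) (fun T => (r,c) ∈ T)
  rw [h3, ← h2] at h4
  omega

/-- pairs extendable both ways -/
def PC (S : F) (r c : ℕ) (T : F) : Prop := ∀ i j, (i,c) ∈ S → i ≠ r → (r,j) ∈ S → j ≠ c →
  ((i,c) ∈ T → (r,j) ∈ T → (i,j) ∈ T) ∧ ((i,j) ∈ T → (i,c) ∈ T ∨ (r,j) ∈ T)

lemma XOK_mono {S S' T : F} (h : S' ⊆ S) (hx : XOK S T) : XOK S' T :=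
  fun i i' j j' a b d e => hx i i' j j' (h a) (h b) (h d) (h e)

lemma X_rec1 {S : F} {r c : ℕ} (h : Corner S r c) [DecidablePred (PC S r c)] :
    (XS S).card = (XS (S.erase (r,c))).card + ((XS (S.erase (r,c))).filter (PC S r c)).card := by
  classical
  set X1 := XS (S.erase (r,c)) with hX1
  have hm := h.mem
  have k0 : ∀ T ∈ X1, (XOK S T ↔ ∀ i j, (i,c) ∈ S → i ≠ r → (r,j) ∈ S → j ≠ c →
      ((i,c) ∈ T → (r,j) ∈ T → (i,j) ∈ T)) := by
    intro T hT
    obtain ⟨hs, hl⟩ := mem_XS.1 hT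
    have hx : (r,c) ∉ T := fun hh => by simpa using hs hh
    constructor
    · intro hS i j a b d e f g
      have := hS i r c j a (h.rect _ _ a d) hm d f g
      tauto
    · intro hS i i' j j' a b d e f g
      by_cases h1 : (i,j') = (r,c)
      · grind
      by_cases h2 : (i',j) = (r,c)
      · grind
      exact hl i i' j j' (by grind) (by grind) (by grind) (by grind) f g
  have k1 : ∀ T ∈ X1, (XOK S (insert (r,c) T) ↔ ∀ i j, (i,c) ∈ S → i ≠ r → (r,j) ∈ S → j ≠ c →
      ((i,j) ∈ T → (i,c) ∈ T ∨ (r,j) ∈ T)) := by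
    intro T hT
    obtain ⟨hs, hl⟩ := mem_XS.1 hT
    have hx : (r,c) ∉ T := fun hh => by simpa using hs hh
    constructor
    · intro hS i j a b d e f
      have := hS i r j c (h.rect _ _ a d) a d hm (by grind) (by grind)
      grind
    · intro hS i i' j j' a b d e f g
      by_cases h1 : (i,j) = (r,c)
      · grind
      by_cases h2 : (i',j') = (r,c)
      · grind
      have := hl i i' j j'
      grind
  have e1 : (XS S).filter (fun T => (r,c) ∉ T) = X1.filter (fun T => XOK S T) := by
    ext T
    simp only [Finset.mem_filter, hX1, mem_XS]
    constructor
    · rintro ⟨⟨a, b⟩, d⟩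
      exact ⟨⟨by grind, XOK_mono (Finset.erase_subset _ _) b⟩, b⟩
    · rintro ⟨⟨a, b⟩, d⟩
      exact ⟨⟨by grind, d⟩, by grind⟩
  have e2 : ((XS S).filter (fun T => (r,c) ∈ T)).card
      = (X1.filter (fun T => XOK S (insert (r,c) T))).card := by
    apply Finset.card_nbij' (fun T => T.erase (r,c)) (fun T => insert (r,c) T)
    · intro T hT
      simp only [Finset.coe_filter, Set.mem_ofPred_eq, hX1, mem_XS] at hT ⊢
      obtain ⟨⟨hs, hl⟩, hx⟩ := hT
      refine ⟨⟨Finset.erase_subset_erase _ hs, ?_⟩, by rwa [Finset.insert_erase hx]⟩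
      intro i i' j j'
      have := hl i i' j j'
      grind
    · intro T hT
      simp only [Finset.coe_filter, Set.mem_ofPred_eq, hX1, mem_XS] at hT ⊢
      obtain ⟨⟨hs, hl⟩, hx⟩ := hT
      exact ⟨⟨by grind, hx⟩, by simp⟩
    · intro T hT
      have : (r,c) ∈ T := by simpa using (Finset.mem_filter.1 hT).2
      simp [Finset.insert_erase this]
    · intro T hT
      have := (mem_XS.1 (Finset.mem_filter.1 hT).1).1
      have : (r,c) ∉ T := fun hh => by simpa using this hh
      simp [this]
  have e3 : X1.filter (fun T => XOK S T) ∪ X1.filter (fun T => XOK S (insert (r,c) T)) = X1 := by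
    rw [← Finset.filter_or]
    apply Finset.filter_true_of_mem
    intro T hT
    rw [k0 T hT, k1 T hT]
    obtain ⟨hs, hl⟩ := mem_XS.1 hT
    by_contra! hcon
    obtain ⟨⟨i1, j1, a1, a2, a3, a4, a5, a6, a7⟩, ⟨i2, j2, b1, b2, b3, b4, b5, b6, b7⟩⟩ := hcon
    have q1 := h.rect _ _ a1 b3
    have q2 := h.rect _ _ b1 a3
    have q3 := h.rect _ _ a1 a3
    have q4 := h.rect _ _ b1 b3
    have mk : ∀ {i j}, (i,j) ∈ S → (i ≠ r ∨ j ≠ c) → (i,j) ∈ S.erase (r,c) := by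
      intro i j u v
      simp only [Finset.mem_erase, ne_eq, Prod.mk.injEq]; tauto
    have u1 := hl i1 i2 c j2 (mk a1 (Or.inl a2)) (mk q1 (Or.inl a2)) (mk b1 (Or.inl b2))
      (mk q4 (Or.inl b2)) a5 b5
    have u1 : (i1,j2) ∈ T := by tauto
    have u3 := hl i1 r j2 j1 (mk q1 (Or.inl a2)) (mk q3 (Or.inl a2)) (mk b3 (Or.inr b4))
      (mk a3 (Or.inr a4)) u1 a6
    tauto
  have e4 : X1.filter (fun T => XOK S T) ∩ X1.filter (fun T => XOK S (insert (r,c) T))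
      = X1.filter (PC S r c) := by
    rw [← Finset.filter_and]
    apply Finset.filter_congr
    intro T hT
    rw [k0 T hT, k1 T hT]
    unfold PC
    constructor
    · rintro ⟨u, v⟩ i j a b d e
      exact ⟨u i j a b d e, v i j a b d e⟩
    · intro u
      exact ⟨fun i j a b d e => (u i j a b d e).1, fun i j a b d e => (u i j a b d e).2⟩
  have h4 := Finset.card_union_add_card_inter (X1.filter (fun T => XOK S T))
    (X1.filter (fun T => XOK S (insert (r,c) T)))
  have h5 := Finset.card_filter_add_card_filter_not (s := XS S) (fun T => (r,c) ∈ T)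
  rw [e3, e4] at h4
  rw [e1, e2] at h5
  omega


/-- the free row is as full as possible -/
def FP (S : F) (r c : ℕ) (T : F) : Prop := ∀ j, (r,j) ∈ S → j ≠ c →
  (∀ i, (i,c) ∈ S → i ≠ r → (i,c) ∈ T → (i,j) ∈ T) → (r,j) ∈ T

/-- the free column is as empty as possible -/
def GP (S : F) (r c : ℕ) (T : F) : Prop := ∀ i, (i,c) ∈ S → i ≠ r → (i,c) ∈ T →
  ∃ j, (r,j) ∈ S ∧ j ≠ c ∧ (r,j) ∉ T ∧ (i,j) ∈ T

open Classical in
noncomputable def phi (S : F) (r c : ℕ) (U : F) : F :=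
  U ∪ (S.filter (fun p => p.1 = r ∧ p.2 ≠ c ∧ ∀ i, (i,c) ∈ S → i ≠ r → (i,c) ∈ U → (i,p.2) ∈ U))

open Classical in
noncomputable def psi (S : F) (r c : ℕ) (V : F) : F :=
  V ∪ (S.filter (fun p => p.2 = c ∧ p.1 ≠ r ∧ ∃ j, (r,j) ∈ S ∧ j ≠ c ∧ (r,j) ∉ V ∧ (p.1,j) ∈ V))

lemma cardFP {S : F} {r c : ℕ} (h : Corner S r c) [DecidablePred (PC S r c)]
    [DecidablePred (FP S r c)] :
    (((XS (S.erase (r,c))).filter (PC S r c)).filter (FP S r c)).card = (XS (dr S r)).card := by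
  have hm := h.mem
  have m1 : ∀ U : F, ∀ i j, i ≠ r → ((i,j) ∈ phi S r c U ↔ (i,j) ∈ U) := by
    intro U i j hi; simp [phi, hi]
  have m2 : ∀ U : F, U ⊆ dr S r → ∀ j, ((r,j) ∈ phi S r c U ↔ (r,j) ∈ S ∧ j ≠ c ∧
      ∀ i, (i,c) ∈ S → i ≠ r → (i,c) ∈ U → (i,j) ∈ U) := by
    intro U hU j
    have : (r,j) ∉ U := fun hh => by simpa [mem_dr] using hU hh
    simp [phi, this]
  apply Finset.card_nbij' (fun T => dr T r) (fun U => phi S r c U)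
  · intro T hT
    simp only [Finset.coe_filter, Set.mem_ofPred_eq, SetLike.mem_coe, Finset.mem_filter, mem_XS] at hT ⊢
    obtain ⟨⟨⟨hs, hl⟩, hp⟩, hf⟩ := hT
    refine ⟨?_, ?_⟩
    · intro p hp
      rw [mem_dr] at hp ⊢
      exact ⟨Finset.mem_of_mem_erase (hs hp.1), hp.2⟩
    · intro i i' j j'
      have := hl i i' j j'
      simp only [mem_dr, Finset.mem_erase, ne_eq, Prod.mk.injEq] at *
      tauto
  · intro U hU
    simp only [Finset.coe_filter, Set.mem_ofPred_eq, SetLike.mem_coe, Finset.mem_filter, mem_XS] at hU ⊢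
    obtain ⟨hs, hl⟩ := hU
    have m2 := m2 U hs
    have m1 := m1 U
    have hl' : ∀ i i' j j', i ≠ r → i' ≠ r → (i,j') ∈ S → (i',j) ∈ S → (i,j) ∈ U → (i',j') ∈ U →
        (i,j') ∈ U ∨ (i',j) ∈ U := by
      intro i i' j j' a b d e f g
      exact hl i i' j j' (hs f) (mem_dr.2 ⟨d, a⟩) (mem_dr.2 ⟨e, b⟩) (hs g) f g
    have hsub : ∀ p ∈ U, p ∈ S := fun p hp => (mem_dr.1 (hs hp)).1
    refine ⟨⟨⟨?_, ?_⟩, ?_⟩, ?_⟩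
    · rintro ⟨i, j⟩ hp
      by_cases hi : i = r
      · subst hi; have := (m2 j).1 hp
        simp only [Finset.mem_erase, ne_eq, Prod.mk.injEq]; tauto
      · have := (m1 i j hi).1 hp
        have := hsub _ this
        simp only [Finset.mem_erase, ne_eq, Prod.mk.injEq]; tauto
    · intro i i' j j' a b d e f g
      simp only [Finset.mem_erase, ne_eq, Prod.mk.injEq] at a b d e
      by_cases hi : i = r
      · by_cases hi' : i' = r
        · subst hi; subst hi'; tauto
        · subst hi
          rw [m1 _ _ hi'] at g ⊢
          by_contra! hcon
          obtain ⟨q1, q2⟩ := hcon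
          rw [m2] at f q1
          push Not at q1
          obtain ⟨k, k1, k2, k3, k4⟩ := q1 b.2 (by tauto)
          have k5 := f.2.2 k k1 k2 k3
          have := hl' k i' j j' k2 hi' (h.rect _ _ k1 b.2) d.2 k5 g
          tauto
      · by_cases hi' : i' = r
        · subst hi'
          rw [m1 _ _ hi] at f ⊢
          by_contra! hcon
          obtain ⟨q1, q2⟩ := hcon
          rw [m2] at g q2
          push Not at q2
          obtain ⟨k, k1, k2, k3, k4⟩ := q2 d.2 (by tauto)
          have k5 := g.2.2 k k1 k2 k3
          have := hl' i k j j' hi k2 b.2 (h.rect _ _ k1 d.2) f k5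
          tauto
        · rw [m1 _ _ hi] at f ⊢
          rw [m1 _ _ hi'] at g ⊢
          exact hl' i i' j j' hi hi' b.2 d.2 f g
    · intro i j a b d e
      rw [m1 _ _ b, m1 _ _ b]
      refine ⟨fun f g => ((m2 j).1 g).2.2 i a b f, fun f => ?_⟩
      by_contra! hcon
      obtain ⟨q1, q2⟩ := hcon
      rw [m2] at q2
      push Not at q2
      obtain ⟨k, k1, k2, k3, k4⟩ := q2 d e
      have := hl' i k j c b k2 a (h.rect _ _ k1 d) f k3
      tauto
    · intro j a b d
      rw [m2]
      refine ⟨a, b, fun i e f g => ?_⟩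
      have := d i e f
      rw [m1 _ _ f, m1 _ _ f] at this
      exact this g
  · intro T hT
    simp only [Finset.coe_filter, Set.mem_ofPred_eq, SetLike.mem_coe, Finset.mem_filter, mem_XS] at hT ⊢
    obtain ⟨⟨⟨hs, hl⟩, hp⟩, hf⟩ := hT
    ext ⟨i, j⟩
    by_cases hi : i = r
    · subst hi
      rw [m2 _ (fun p hp => by
        rw [mem_dr] at hp ⊢
        exact ⟨Finset.mem_of_mem_erase (hs hp.1), hp.2⟩)]
      constructor
      · rintro ⟨a, b, d⟩
        apply hf j a b
        intro k k1 k2 k3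
        exact (mem_dr.1 (d k k1 k2 (mem_dr.2 ⟨k3, k2⟩))).1
      · intro a
        have a' := hs a
        simp only [Finset.mem_erase, ne_eq, Prod.mk.injEq] at a'
        have a1 : j ≠ c := by tauto
        refine ⟨a'.2, a1, fun k k1 k2 k3 => mem_dr.2 ⟨?_, k2⟩⟩
        exact (hp k j k1 k2 a'.2 a1).1 (mem_dr.1 k3).1 a
    · rw [m1 _ _ _ hi, mem_dr]; tauto
  · intro U hU
    obtain ⟨hs, hl⟩ := mem_XS.1 hU
    ext ⟨i, j⟩
    rw [mem_dr]
    constructor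
    · rintro ⟨a, b⟩; exact (m1 _ _ _ b).1 a
    · intro a
      have b := (mem_dr.1 (hs a)).2
      exact ⟨(m1 _ _ _ b).2 a, b⟩

lemma cardGP {S : F} {r c : ℕ} (h : Corner S r c) [DecidablePred (PC S r c)]
    [DecidablePred (GP S r c)] :
    (((XS (S.erase (r,c))).filter (PC S r c)).filter (GP S r c)).card = (XS (dc S c)).card := by
  have hm := h.mem
  have m1 : ∀ U : F, ∀ i j, j ≠ c → ((i,j) ∈ psi S r c U ↔ (i,j) ∈ U) := by
    intro U i j hi; simp [psi, hi]
  have m2 : ∀ U : F, U ⊆ dc S c → ∀ i, ((i,c) ∈ psi S r c U ↔ (i,c) ∈ S ∧ i ≠ r ∧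
      ∃ j, (r,j) ∈ S ∧ j ≠ c ∧ (r,j) ∉ U ∧ (i,j) ∈ U) := by
    intro U hU j
    have : (j,c) ∉ U := fun hh => by simpa [mem_dc] using hU hh
    simp [psi, this]
  apply Finset.card_nbij' (fun T => dc T c) (fun U => psi S r c U)
  · intro T hT
    simp only [Finset.coe_filter, Set.mem_ofPred_eq, SetLike.mem_coe, Finset.mem_filter, mem_XS] at hT ⊢
    obtain ⟨⟨⟨hs, hl⟩, hp⟩, hf⟩ := hT
    refine ⟨?_, ?_⟩
    · intro p hp
      rw [mem_dc] at hp ⊢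
      exact ⟨Finset.mem_of_mem_erase (hs hp.1), hp.2⟩
    · intro i i' j j'
      have := hl i i' j j'
      simp only [mem_dc, Finset.mem_erase, ne_eq, Prod.mk.injEq] at *
      tauto
  · intro U hU
    simp only [Finset.coe_filter, Set.mem_ofPred_eq, SetLike.mem_coe, Finset.mem_filter, mem_XS] at hU ⊢
    obtain ⟨hs, hl⟩ := hU
    have m2 := m2 U hs
    have m1 := m1 U
    have hl' : ∀ i i' j j', j ≠ c → j' ≠ c → (i,j') ∈ S → (i',j) ∈ S → (i,j) ∈ U → (i',j') ∈ U →
        (i,j') ∈ U ∨ (i',j) ∈ U := by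
      intro i i' j j' a b d e f g
      exact hl i i' j j' (hs f) (mem_dc.2 ⟨d, b⟩) (mem_dc.2 ⟨e, a⟩) (hs g) f g
    have hsub : ∀ p ∈ U, p ∈ S := fun p hp => (mem_dc.1 (hs hp)).1
    refine ⟨⟨⟨?_, ?_⟩, ?_⟩, ?_⟩
    · rintro ⟨i, j⟩ hp
      by_cases hi : j = c
      · subst hi; have := (m2 i).1 hp
        simp only [Finset.mem_erase, ne_eq, Prod.mk.injEq]; tauto
      · have := (m1 i j hi).1 hp
        have := hsub _ this
        simp only [Finset.mem_erase, ne_eq, Prod.mk.injEq]; tauto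
    · intro i i' j j' a b d e f g
      simp only [Finset.mem_erase, ne_eq, Prod.mk.injEq] at a b d e
      by_cases hi : j = c
      · by_cases hi' : j' = c
        · subst hi; subst hi'; tauto
        · subst hi
          rw [m1 _ _ hi'] at g ⊢
          by_contra! hcon
          obtain ⟨q1, q2⟩ := hcon
          rw [m2] at f q2
          push Not at q2
          obtain ⟨f1, f2, k, k1, k2, k3, k4⟩ := f
          have k5 := q2 d.2 (by tauto) k k1 k2 k3
          have := hl' i i' k j' k2 hi' b.2 (h.rect _ _ d.2 k1) k4 g
          tauto
      · by_cases hi' : j' = c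
        · subst hi'
          rw [m1 _ _ hi] at f ⊢
          by_contra! hcon
          obtain ⟨q1, q2⟩ := hcon
          rw [m2] at g q1
          push Not at q1
          obtain ⟨f1, f2, k, k1, k2, k3, k4⟩ := g
          have k5 := q1 b.2 (by tauto) k k1 k2 k3
          have := hl' i i' j k hi k2 (h.rect _ _ b.2 k1) d.2 f k4
          tauto
        · rw [m1 _ _ hi'] at g ⊢
          rw [m1 _ _ hi] at f ⊢
          exact hl' i i' j j' hi hi' b.2 d.2 f g
    · intro i j a b d e
      rw [m1 _ _ e, m1 _ _ e]
      refine ⟨fun f g => ?_, fun f => ?_⟩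
      · obtain ⟨f1, f2, k, k1, k2, k3, k4⟩ := (m2 i).1 f
        have := hl' i r k j k2 e (h.rect _ _ a d) k1 k4 g
        tauto
      · by_contra! hcon
        obtain ⟨q1, q2⟩ := hcon
        rw [m2] at q1
        push Not at q1
        exact q1 a b j d e q2 f
    · intro i a b d
      rw [m2] at d
      obtain ⟨f1, f2, k, k1, k2, k3, k4⟩ := d
      exact ⟨k, k1, k2, by rwa [m1 _ _ k2], by rwa [m1 _ _ k2]⟩
  · intro T hT
    simp only [Finset.coe_filter, Set.mem_ofPred_eq, SetLike.mem_coe, Finset.mem_filter, mem_XS] at hT ⊢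
    obtain ⟨⟨⟨hs, hl⟩, hp⟩, hf⟩ := hT
    ext ⟨i, j⟩
    by_cases hi : j = c
    · subst hi
      rw [m2 _ (fun p hp => by
        rw [mem_dc] at hp ⊢
        exact ⟨Finset.mem_of_mem_erase (hs hp.1), hp.2⟩)]
      constructor
      · rintro ⟨a, b, k, k1, k2, k3, k4⟩
        have := (hp i k a b k1 k2).2 (mem_dc.1 k4).1
        rw [mem_dc] at k3
        tauto
      · intro a
        have a' := hs a
        simp only [Finset.mem_erase, ne_eq, Prod.mk.injEq] at a'
        have a1 : i ≠ r := by tauto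
        obtain ⟨k, k1, k2, k3, k4⟩ := hf i a'.2 a1 a
        exact ⟨a'.2, a1, k, k1, k2, fun hh => k3 (mem_dc.1 hh).1, mem_dc.2 ⟨k4, k2⟩⟩
    · rw [m1 _ _ _ hi, mem_dc]; tauto
  · intro U hU
    obtain ⟨hs, hl⟩ := mem_XS.1 hU
    ext ⟨i, j⟩
    rw [mem_dc]
    constructor
    · rintro ⟨a, b⟩; exact (m1 _ _ _ b).1 a
    · intro a
      have b := (mem_dc.1 (hs a)).2
      exact ⟨(m1 _ _ _ b).2 a, b⟩

lemma FG_empty {S T : F} {r c : ℕ} (h : Corner S r c) (hT : T ∈ XS (S.erase (r,c)))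
    (hf : FP S r c T) (hg : GP S r c T) : ∀ i, (i,c) ∉ T := by
  classical
  obtain ⟨hs, hl⟩ := mem_XS.1 hT
  intro i0 hi0
  have hne : (T.filter (fun p => p.2 = c)).Nonempty := ⟨(i0,c), by simp [hi0]⟩
  obtain ⟨⟨i, c'⟩, him, hmax⟩ := Finset.exists_max_image _
    (fun p : ℕ × ℕ => ((S.filter (fun q => q.1 = r ∧ q.2 ≠ c)).filter (fun q => (p.1,q.2) ∉ T)).card) hne
  simp only [Finset.mem_filter] at him
  obtain ⟨hi, rfl⟩ := him
  have hS : ∀ i, (i,c') ∈ T → (i,c') ∈ S ∧ i ≠ r := by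
    intro i hi
    have := hs hi
    simp only [Finset.mem_erase, ne_eq, Prod.mk.injEq] at this
    tauto
  obtain ⟨j, j1, j2, j3, j4⟩ := hg i (hS i hi).1 (hS i hi).2 hi
  have := mt (hf j j1 j2) j3
  push Not at this
  obtain ⟨i', a1, a2, a3, a4⟩ := this
  have h1 := hmax (i',c') (by simp [a3])
  refine absurd h1 (not_le.2 (Finset.card_lt_card ?_))
  rw [Finset.ssubset_iff_of_subset]
  · refine ⟨(r,j), ?_, ?_⟩
    · simp [j1, j2, a4]
    · simp [j4]
  · rintro ⟨r', j''⟩ hq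
    simp only [Finset.mem_filter] at hq ⊢
    refine ⟨hq.1, fun hh => ?_⟩
    obtain ⟨⟨q1, rfl, q2⟩, q3⟩ := hq
    have mk : ∀ {i j}, (i,c') ∈ S → (r',j) ∈ S → (i ≠ r') → (i,j) ∈ S.erase (r',c') := by
      intro i j u v w
      have := h.rect _ _ u v
      simp only [Finset.mem_erase, ne_eq, Prod.mk.injEq]; tauto
    have b := hS i hi
    have := hl i i' j j'' (mk b.1 j1 b.2) (mk b.1 q1 b.2) (mk a1 j1 a2) (mk a1 q1 a2) j4 hh
    tauto

lemma cardFG {S : F} {r c : ℕ} (h : Corner S r c) [DecidablePred (PC S r c)]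
    [DecidablePred (FP S r c)] [DecidablePred (GP S r c)] :
    (((XS (S.erase (r,c))).filter (PC S r c)).filter (fun T => FP S r c T ∧ GP S r c T)).card
      = (XS (dc (dr S r) c)).card := by
  have hm := h.mem
  have key : ∀ U : F, U ⊆ dc (dr S r) c → ∀ i j, ((i,j) ∈ U ∪ (S.erase (r,c)).filter (fun p => p.1 = r) ↔
      ((i ≠ r ∧ j ≠ c ∧ (i,j) ∈ U) ∨ (i = r ∧ j ≠ c ∧ (r,j) ∈ S))) := by
    intro U hU i j
    have h1 := @hU (i,j)
    simp only [mem_dc, mem_dr, Finset.mem_union, Finset.mem_filter, Finset.mem_erase, ne_eq,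
      Prod.mk.injEq] at *
    constructor
    · rintro (a | ⟨a, rfl⟩) <;> tauto
    · rintro (a | ⟨rfl, a⟩) <;> tauto
  have hsub : ∀ T : F, T ⊆ S.erase (r,c) → dc (dr T r) c ⊆ dc (dr S r) c := by
    intro T hs p hp
    simp only [mem_dc, mem_dr] at hp ⊢
    exact ⟨⟨Finset.mem_of_mem_erase (hs hp.1.1), hp.1.2⟩, hp.2⟩
  apply Finset.card_nbij' (fun T => dc (dr T r) c)
    (fun U => U ∪ (S.erase (r,c)).filter (fun p => p.1 = r))
  · intro T hT
    simp only [Finset.coe_filter, Set.mem_ofPred_eq, SetLike.mem_coe, Finset.mem_filter, mem_XS] at hT ⊢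
    obtain ⟨⟨⟨hs, hl⟩, hp⟩, hf⟩ := hT
    refine ⟨hsub T hs, ?_⟩
    intro i i' j j'
    have := hl i i' j j'
    simp only [mem_dc, mem_dr, Finset.mem_erase, ne_eq, Prod.mk.injEq] at *
    tauto
  · intro U hU
    simp only [Finset.coe_filter, Set.mem_ofPred_eq, SetLike.mem_coe, Finset.mem_filter, mem_XS] at hU ⊢
    obtain ⟨hs, hl⟩ := hU
    have k := key U hs
    refine ⟨⟨⟨?_, ?_⟩, ?_⟩, ?_, ?_⟩
    · rintro ⟨i, j⟩ hp
      rw [k] at hp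
      have := @hs (i,j)
      simp only [mem_dc, mem_dr, Finset.mem_erase, ne_eq, Prod.mk.injEq] at *
      rcases hp with hp | ⟨rfl, hp⟩ <;> tauto
    · intro i i' j j' a b d e f g
      have b' := Finset.mem_erase.1 b
      have d' := Finset.mem_erase.1 d
      rw [k] at f g
      by_cases h1 : i = r
      · left
        subst h1
        exact (k _ _).2 (Or.inr ⟨rfl, fun hh => b'.1 (by rw [hh]), b'.2⟩)
      · by_cases h2 : i' = r
        · right
          subst h2
          exact (k _ _).2 (Or.inr ⟨rfl, fun hh => d'.1 (by rw [hh]), d'.2⟩)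
        · have f' : (i,j) ∈ U ∧ j ≠ c := by tauto
          have g' : (i',j') ∈ U ∧ j' ≠ c := by tauto
          rcases hl i i' j j' (hs f'.1) (mem_dc.2 ⟨mem_dr.2 ⟨b'.2, h1⟩, g'.2⟩)
            (mem_dc.2 ⟨mem_dr.2 ⟨d'.2, h2⟩, f'.2⟩) (hs g'.1) f'.1 g'.1 with q | q
          · exact Or.inl (Finset.mem_union_left _ q)
          · exact Or.inr (Finset.mem_union_left _ q)
    · intro i j a b d e
      rw [k, k, k]
      tauto
    · intro j a b d
      rw [k]; tauto
    · intro i a b d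
      rw [k] at d; tauto
  · intro T hT
    simp only [Finset.coe_filter, Set.mem_ofPred_eq, SetLike.mem_coe, Finset.mem_filter] at hT ⊢
    obtain ⟨⟨hX, hp⟩, hf, hg⟩ := hT
    have h0 := FG_empty h hX hf hg
    obtain ⟨hs, hl⟩ := mem_XS.1 hX
    ext ⟨i, j⟩
    rw [key _ (hsub T hs)]
    have h1 := @hs (i,j)
    by_cases hi : i = r
    · subst hi
      have := hf j
      have h2 := h0 i
      have h3 : (i,j) ∈ T → j ≠ c := by rintro hh rfl; exact h2 hh
      simp only [Finset.mem_erase] at h1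
      have : (i,j) ∈ S → j ≠ c → (i,j) ∈ T := fun a b => this a b (fun k _ _ hk => absurd hk (h0 k))
      tauto
    · have h3 : (i,j) ∈ T → j ≠ c := by rintro hh rfl; exact h0 _ hh
      simp only [mem_dc, mem_dr]
      tauto
  · intro U hU
    obtain ⟨hs, hl⟩ := mem_XS.1 hU
    ext ⟨i, j⟩
    rw [mem_dc, mem_dr, key U hs]
    have := @hs (i,j)
    simp only [mem_dc, mem_dr] at *
    tauto

lemma XS_rec {S : F} {r c : ℕ} (h : Corner S r c) :
    (XS S).card + (XS (dc (dr S r) c)).card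
      = (XS (S.erase (r,c))).card + (XS (dr S r)).card + (XS (dc S c)).card := by
  classical
  rw [X_rec1 h, ← cardFG h, ← cardFP h, ← cardGP h, Finset.filter_and]
  set P := (XS (S.erase (r,c))).filter (PC S r c) with hP
  have h1 := Finset.card_union_add_card_inter (P.filter (FP S r c)) (P.filter (GP S r c))
  have h2 : P.filter (FP S r c) ∪ P.filter (GP S r c) = P := by
    rw [← Finset.filter_or]
    apply Finset.filter_true_of_mem
    intro T hT
    by_contra! hcon
    obtain ⟨a, b⟩ := hcon
    unfold FP at a
    unfold GP at b
    push Not at a b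
    obtain ⟨j, j1, j2, j3, j4⟩ := a
    obtain ⟨i, i1, i2, i3, i4⟩ := b
    exact i4 j j1 j2 j4 (j3 i i1 i2 i3)
  rw [h2] at h1
  omega

def Good (S : F) : Prop := ∀ i i' j k, i < i' → (i',j) ∈ S → (i,k) ∈ S → (i,j) ∈ S

lemma good_dr {S : F} (h : Good S) (r : ℕ) : Good (dr S r) := by
  intro i i' j k a b d
  simp only [mem_dr] at *
  exact ⟨h i i' j k a b.1 d.1, d.2⟩

lemma good_dc {S : F} (h : Good S) (r : ℕ) : Good (dc S r) := by
  intro i i' j k a b d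
  simp only [mem_dc] at *
  exact ⟨h i i' j k a b.1 d.1, b.2⟩

lemma good_erase {S : F} (h : Good S) {r c : ℕ} (hc : Corner S r c) : Good (S.erase (r,c)) := by
  intro i i' j k a b d
  have h1 := h i i' j k a (Finset.mem_of_mem_erase b) (Finset.mem_of_mem_erase d)
  refine Finset.mem_erase.2 ⟨?_, h1⟩
  rintro hh
  obtain ⟨rfl, rfl⟩ := Prod.mk.inj hh
  have := hc.col _ (Finset.mem_of_mem_erase b)
  omega

lemma exists_corner {S : F} (h : Good S) (hne : S.Nonempty) : ∃ r c, Corner S r c := by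
  classical
  obtain ⟨⟨r, c0⟩, h1, hr⟩ := Finset.exists_max_image S (fun p => p.1) hne
  have hne' : (S.filter (fun p => p.1 = r)).Nonempty := ⟨(r,c0), by simp [h1]⟩
  obtain ⟨⟨r', c⟩, h2, hc⟩ := Finset.exists_max_image _ (fun p => p.2) hne'
  simp only [Finset.mem_filter] at h2
  obtain ⟨h2, rfl⟩ := h2
  refine ⟨r', c, h2, ?_, ?_, ?_⟩
  · intro j hj; exact hc (r',j) (by simp [hj])
  · intro i hi; exact hr (i,c) hi
  · intro i j a b
    have := hr _ a
    rcases lt_or_eq_of_le this with g | g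
    · exact h i r' j c g b a
    · simp only at g; subst g; exact b

theorem card_eq (S : F) : Good S → (XS S).card = (LS S).card := by
  induction S using Finset.strongInduction with
  | H S ih =>
    intro hS
    rcases S.eq_empty_or_nonempty with rfl | hne
    · congr 1
      ext T
      simp [mem_XS, mem_LS, XOK, LOK]
    · obtain ⟨r, c, h⟩ := exists_corner hS hne
      have hm := h.mem
      have s1 : S.erase (r,c) ⊂ S := Finset.erase_ssubset hm
      have s2 : dr S r ⊂ S := Finset.filter_ssubset.2 ⟨_, hm, by simp⟩
      have s3 : dc S c ⊂ S := Finset.filter_ssubset.2 ⟨_, hm, by simp⟩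
      have s4 : dc (dr S r) c ⊂ S := lt_of_le_of_lt (Finset.filter_subset _ _) s2
      have e1 := ih _ s1 (good_erase hS h)
      have e2 := ih _ s2 (good_dr hS r)
      have e3 := ih _ s3 (good_dc hS c)
      have e4 := ih _ s4 (good_dc (good_dr hS r) c)
      have := XS_rec h
      have := LS_rec h
      omega


/-- the nonzero lines of a diagram -/
def lines (T : F) : Finset (ℕ ⊕ ℕ) :=
  T.image (fun p => Sum.inl p.1) ∪ T.image (fun p => Sum.inr p.2)

def res (S : F) (M : Finset (ℕ ⊕ ℕ)) : F :=
  S.filter (fun p => Sum.inl p.1 ∈ M ∧ Sum.inr p.2 ∈ M)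

lemma lines_sub {T : F} {M : Finset (ℕ ⊕ ℕ)} :
    lines T ⊆ M ↔ ∀ p ∈ T, Sum.inl p.1 ∈ M ∧ Sum.inr p.2 ∈ M := by
  simp only [lines, Finset.union_subset_iff, Finset.image_subset_iff]
  exact ⟨fun h p hp => ⟨h.1 p hp, h.2 p hp⟩, fun h => ⟨fun p hp => (h p hp).1, fun p hp => (h p hp).2⟩⟩

lemma mem_res {S : F} {M : Finset (ℕ ⊕ ℕ)} {p : ℕ × ℕ} :
    p ∈ res S M ↔ p ∈ S ∧ Sum.inl p.1 ∈ M ∧ Sum.inr p.2 ∈ M := by simp [res]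

lemma sub_res {S T : F} {M : Finset (ℕ ⊕ ℕ)} : T ⊆ res S M ↔ T ⊆ S ∧ lines T ⊆ M := by
  rw [lines_sub]
  constructor
  · intro h
    exact ⟨fun p hp => (mem_res.1 (h hp)).1, fun p hp => (mem_res.1 (h hp)).2⟩
  · rintro ⟨h, h'⟩ p hp
    exact mem_res.2 ⟨h hp, h' p hp⟩

lemma XS_res (S : F) (M : Finset (ℕ ⊕ ℕ)) : (XS S).filter (fun T => lines T ⊆ M) = XS (res S M) := by
  ext T
  simp only [Finset.mem_filter, mem_XS, sub_res]
  constructor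
  · rintro ⟨⟨a, b⟩, d⟩
    exact ⟨⟨a, d⟩, XOK_mono (Finset.filter_subset _ _) b⟩
  · rintro ⟨⟨a, b⟩, d⟩
    refine ⟨⟨a, ?_⟩, b⟩
    intro i i' j j' a1 a2 a3 a4 a5 a6
    have h1 := lines_sub.1 b _ a5
    have h2 := lines_sub.1 b _ a6
    exact d i i' j j' (mem_res.2 ⟨a1, h1⟩) (mem_res.2 ⟨a2, h1.1, h2.2⟩) (mem_res.2 ⟨a3, h2.1, h1.2⟩)
      (mem_res.2 ⟨a4, h2⟩) a5 a6

lemma LS_res (S : F) (M : Finset (ℕ ⊕ ℕ)) : (LS S).filter (fun T => lines T ⊆ M) = LS (res S M) := by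
  ext T
  simp only [Finset.mem_filter, mem_LS, sub_res]
  constructor
  · rintro ⟨⟨a, b⟩, d⟩
    refine ⟨⟨a, d⟩, ?_⟩
    intro i i' j j' h1 h2 a1 a2 a3 a4
    exact b i i' j j' h1 h2 (mem_res.1 a1).1 (mem_res.1 a2).1 (mem_res.1 a3).1 (mem_res.1 a4).1
  · rintro ⟨⟨a, b⟩, d⟩
    refine ⟨⟨a, ?_⟩, b⟩
    intro i i' j j' q1 q2 a1 a2 a3 a4 a5 a6
    have h1 := lines_sub.1 b _ a5
    have h2 := lines_sub.1 b _ a6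
    exact d i i' j j' q1 q2 (mem_res.2 ⟨a1, h1.1, h2.2⟩) (mem_res.2 ⟨a2, h1⟩) (mem_res.2 ⟨a3, h2⟩)
      (mem_res.2 ⟨a4, h2.1, h1.2⟩) a5 a6

lemma good_res {S : F} (h : Good S) (M : Finset (ℕ ⊕ ℕ)) : Good (res S M) := by
  intro i i' j k a b d
  simp only [mem_res] at *
  exact ⟨h i i' j k a b.1 d.1, d.2.1, b.2.2⟩

lemma moebius {A B : Finset F}
    (h : ∀ M, (A.filter (fun T => lines T ⊆ M)).card = (B.filter (fun T => lines T ⊆ M)).card)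
    (M : Finset (ℕ ⊕ ℕ)) :
    (A.filter (fun T => lines T = M)).card = (B.filter (fun T => lines T = M)).card := by
  induction M using Finset.strongInduction with
  | H M ih =>
    have key : ∀ A : Finset F, (A.filter (fun T => lines T ⊆ M)).card
        = ∑ M' ∈ M.powerset.erase M, (A.filter (fun T => lines T = M')).card
          + (A.filter (fun T => lines T = M)).card := by
      intro A
      rw [Finset.sum_erase_add _ _ (Finset.mem_powerset_self M),
        Finset.card_eq_sum_card_fiberwise (f := lines) (t := M.powerset)]
      · apply Finset.sum_congr rfl
        intro M' hM'
        rw [Finset.filter_filter]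
        congr 1
        apply Finset.filter_congr
        intro T _
        have := Finset.mem_powerset.1 hM'
        constructor
        · exact fun hh => hh.2
        · rintro rfl; exact ⟨this, rfl⟩
      · intro T hT
        simpa using (Finset.mem_filter.1 hT).2
    have h1 := h M
    rw [key A, key B] at h1
    have h2 : ∑ M' ∈ M.powerset.erase M, (A.filter (fun T => lines T = M')).card
        = ∑ M' ∈ M.powerset.erase M, (B.filter (fun T => lines T = M')).card := by
      apply Finset.sum_congr rfl
      intro M' hM'
      rw [Finset.mem_erase, Finset.mem_powerset] at hM'
      exact ih M' (lt_of_le_of_ne hM'.2 hM'.1)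
    omega

lemma exists_equiv {S : F} (h : Good S) :
    ∃ e : {T // T ∈ XS S} ≃ {T // T ∈ LS S}, ∀ T, lines (e T).1 = lines T.1 := by
  have hc := moebius (A := XS S) (B := LS S)
    (fun M => by rw [XS_res, LS_res]; exact card_eq _ (good_res h M))
  have fe : ∀ M, Nonempty ({T : {T // T ∈ XS S} // lines T.1 = M}
      ≃ {T : {T // T ∈ LS S} // lines T.1 = M}) := by
    intro M
    have h1 : ∀ A : Finset F, Nonempty ({T : {T // T ∈ A} // lines T.1 = M} ≃
        {T // T ∈ A.filter (fun T => lines T = M)}) := by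
      intro A
      exact ⟨(Equiv.subtypeSubtypeEquivSubtypeInter (fun T => T ∈ A) (fun T => lines T = M)).trans
        (Equiv.subtypeEquivRight (fun T => by simp))⟩
    obtain ⟨e1⟩ := h1 (XS S)
    obtain ⟨e2⟩ := h1 (LS S)
    exact ⟨e1.trans ((Finset.equivOfCardEq (hc M)).trans e2.symm)⟩
  exact ⟨Equiv.ofFiberEquiv (f := fun T : {T // T ∈ XS S} => lines T.1)
    (g := fun T : {T // T ∈ LS S} => lines T.1) (fun M => (fe M).some),
    fun T => Equiv.ofFiberEquiv_map (f := fun T : {T // T ∈ XS S} => lines T.1)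
      (g := fun T : {T // T ∈ LS S} => lines T.1) (fun M => (fe M).some) T⟩

def supp (S : F) (T : ℕ × ℕ → Bool) : F := S.filter (fun p => T p = true)

lemma supp_mem {S : F} {T : ℕ × ℕ → Bool} (h : IsFilling S T) (p : ℕ × ℕ) :
    p ∈ supp S T ↔ T p = true := by
  have := h p
  simp only [supp, Finset.mem_filter]
  constructor
  · exact fun a => a.2
  · intro a
    refine ⟨?_, a⟩
    by_contra hh
    rw [this hh] at a; simp at a

lemma X_iff {S : F} {T : ℕ × ℕ → Bool} (h : IsFilling S T) :
    IsXDiagram S T ↔ supp S T ∈ XS S := by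
  rw [mem_XS]
  unfold IsXDiagram Avoids XOK
  simp only [supp_mem h]
  constructor
  · rintro ⟨-, h1, h2⟩
    refine ⟨Finset.filter_subset _ _, ?_⟩
    intro i i' j j' a1 a2 a3 a4 a5 a6
    by_contra! hcon
    obtain ⟨q1, q2⟩ := hcon
    simp only [ne_eq, Bool.not_eq_true] at q1 q2
    rcases lt_trichotomy i i' with u | rfl | u
    · rcases lt_trichotomy j j' with v | rfl | v
      · exact h1 ⟨i, i', j, j', u, v, a1, a2, a3, a4, a5, q1, q2, a6⟩
      · simp_all
      · exact h2 ⟨i, i', j', j, u, v, a2, a1, a4, a3, q1, a5, a6, q2⟩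
    · simp_all
    · rcases lt_trichotomy j j' with v | rfl | v
      · exact h2 ⟨i', i, j, j', u, v, a3, a4, a1, a2, q2, a6, a5, q1⟩
      · simp_all
      · exact h1 ⟨i', i, j', j, u, v, a4, a3, a2, a1, a6, q2, q1, a5⟩
  · rintro ⟨-, hx⟩
    refine ⟨h, ?_, ?_⟩
    · rintro ⟨i, i', j, j', u, v, a1, a2, a3, a4, b1, b2, b3, b4⟩
      have := hx i i' j j' a1 a2 a3 a4 b1 b4
      simp_all
    · rintro ⟨i, i', j, j', u, v, a1, a2, a3, a4, b1, b2, b3, b4⟩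
      have := hx i i' j' j a2 a1 a4 a3 b2 b3
      simp_all

lemma L_iff {S : F} {T : ℕ × ℕ → Bool} (h : IsFilling S T) :
    IsLeDiagram S T ↔ supp S T ∈ LS S := by
  rw [mem_LS]
  unfold IsLeDiagram Avoids LOK
  simp only [supp_mem h]
  constructor
  · rintro ⟨-, h1, h2⟩
    refine ⟨Finset.filter_subset _ _, ?_⟩
    intro i i' j j' u v a1 a2 a3 a4 a5 a6
    by_contra hcon
    simp only [Bool.not_eq_true] at hcon
    rcases hq : T (i,j) with _ | _
    · exact h2 ⟨i, i', j, j', u, v, a1, a2, a3, a4, hq, a5, a6, hcon⟩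
    · exact h1 ⟨i, i', j, j', u, v, a1, a2, a3, a4, hq, a5, a6, hcon⟩
  · rintro ⟨-, hx⟩
    refine ⟨h, ?_, ?_⟩ <;>
    · rintro ⟨i, i', j, j', u, v, a1, a2, a3, a4, b1, b2, b3, b4⟩
      have := hx i i' j j' u v a1 a2 a3 a4 b2 b3
      simp_all

lemma fill_char {S U : F} (hU : U ⊆ S) : IsFilling S (fun p => decide (p ∈ U)) := by
  intro p hp
  simpa using fun hh => hp (hU hh)

lemma supp_char {S U : F} (hU : U ⊆ S) : supp S (fun p => decide (p ∈ U)) = U := by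
  ext p
  rw [supp_mem (fill_char hU)]; simp

lemma char_supp {S : F} {T : ℕ × ℕ → Bool} (h : IsFilling S T) :
    (fun p => decide (p ∈ supp S T)) = T := by
  funext p
  rw [Bool.eq_iff_iff]
  simp [supp_mem h]

def eX (S : F) : {T // IsXDiagram S T} ≃ {U // U ∈ XS S} where
  toFun T := ⟨supp S T.1, (X_iff T.2.1).1 T.2⟩
  invFun U := ⟨fun p => decide (p ∈ U.1), (X_iff (fill_char (mem_XS.1 U.2).1)).2
    (by rw [supp_char (mem_XS.1 U.2).1]; exact U.2)⟩
  left_inv T := Subtype.ext (char_supp T.2.1)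
  right_inv U := Subtype.ext (supp_char (mem_XS.1 U.2).1)

def eL (S : F) : {T // IsLeDiagram S T} ≃ {U // U ∈ LS S} where
  toFun T := ⟨supp S T.1, (L_iff T.2.1).1 T.2⟩
  invFun U := ⟨fun p => decide (p ∈ U.1), (L_iff (fill_char (mem_LS.1 U.2).1)).2
    (by rw [supp_char (mem_LS.1 U.2).1]; exact U.2)⟩
  left_inv T := Subtype.ext (char_supp T.2.1)
  right_inv U := Subtype.ext (supp_char (mem_LS.1 U.2).1)

lemma zr_iff (S : F) (T : ℕ × ℕ → Bool) (i : ℕ) :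
    ZeroRow S T i ↔ Sum.inl i ∉ lines (supp S T) := by
  simp [ZeroRow, lines, supp]

lemma zc_iff (S : F) (T : ℕ × ℕ → Bool) (i : ℕ) :
    ZeroCol S T i ↔ Sum.inr i ∉ lines (supp S T) := by
  simp [ZeroCol, lines, supp]

end XLe

/-- there is a bijection between X-diagrams and Le-diagrams of a
given Young-diagram shape preserving the set of zero-rows and of zero-columns. -/
theorem stmt1 (μ : YoungDiagram) :
    ∃ Φ : {T : ℕ × ℕ → Bool // IsXDiagram μ.cells T} ≃
          {T : ℕ × ℕ → Bool // IsLeDiagram μ.cells T},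
      ∀ T : {T : ℕ × ℕ → Bool // IsXDiagram μ.cells T},
        (∀ i, ZeroRow μ.cells T.1 i ↔ ZeroRow μ.cells (Φ T).1 i) ∧
        (∀ j, ZeroCol μ.cells T.1 j ↔ ZeroCol μ.cells (Φ T).1 j) := by
  have hg : XLe.Good μ.cells := by
    intro i i' j k a b _
    exact μ.isLowerSet (show ((i,j) : ℕ × ℕ) ≤ (i',j) from ⟨a.le, le_rfl⟩) b
  obtain ⟨e, he⟩ := XLe.exists_equiv hg
  refine ⟨(XLe.eX μ.cells).trans (e.trans (XLe.eL μ.cells).symm), fun T => ?_⟩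
  have h1 : XLe.lines (XLe.supp μ.cells
      (((XLe.eX μ.cells).trans (e.trans (XLe.eL μ.cells).symm)) T).1)
      = XLe.lines (XLe.supp μ.cells T.1) := by
    have h2 : XLe.supp μ.cells (((XLe.eX μ.cells).trans (e.trans (XLe.eL μ.cells).symm)) T).1
        = (e (XLe.eX μ.cells T)).1 :=
      congrArg Subtype.val ((XLe.eL μ.cells).apply_symm_apply (e (XLe.eX μ.cells T)))
    rw [h2, he]
    rfl
  refine ⟨fun i => ?_, fun j => ?_⟩
  · rw [XLe.zr_iff, XLe.zr_iff, h1]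
  · rw [XLe.zc_iff, XLe.zc_iff, h1]
end

section
/- For every Young diagram λ with k rows there exists a bijection φ from the set of X-diagrams of shape λ onto the set of mixed diagrams of shape λ such that for every X-diagram T, the diagrams T and φ(T) have the same set of zero-rows and the same set of zero-columns. -/
/-- The two X-avoidance conditions, without the filling condition. -/
def AvoidsX (S : Finset (ℕ × ℕ)) (T : ℕ × ℕ → Bool) : Prop :=
  Avoids S T true false false true ∧ Avoids S T false true true false

/-- A mixed diagram on a shape with `k` rows (rows `0, …, k-1`, row `k-1` at the
bottom): the top `k-1` rows form an X-diagram, and every 0 in the bottom row has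
no 1 above it in its column or no 1 to its left in its row. -/
def IsMixed (S : Finset (ℕ × ℕ)) (k : ℕ) (T : ℕ × ℕ → Bool) : Prop :=
  IsFilling S T ∧
  AvoidsX (S.filter (fun c => c.1 + 1 < k)) T ∧
  ∀ j, (k - 1, j) ∈ S → T (k - 1, j) = false →
    (∀ i, i + 1 < k → (i, j) ∈ S → T (i, j) = false) ∨
    (∀ j', j' < j → (k - 1, j') ∈ S → T (k - 1, j') = false)

/-- Minimal columns among those with a 1 in the bottom row `r`. -/
def InN (r : ℕ) (T : ℕ × ℕ → Bool) (j : ℕ) : Prop :=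
  T (r, j) = true ∧ ∀ j', T (r, j') = true → ∀ i, i < r → T (i, j) = true → T (i, j') = true

def Sec (r : ℕ) (T : ℕ × ℕ → Bool) (j : ℕ) : Prop := ∃ p, p < j ∧ InN r T p

def NZ (r : ℕ) (T : ℕ × ℕ → Bool) (j : ℕ) : Prop := ∃ i, i < r ∧ T (i, j) = true

open Classical in
noncomputable def fwd (S : Finset (ℕ × ℕ)) (r : ℕ) (T : ℕ × ℕ → Bool) (c : ℕ × ℕ) : Bool :=
  if c.1 < r then decide (T c = true ∧ ¬ (InN r T c.2 ∧ Sec r T c.2))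
  else if c.1 = r then decide (InN r T c.2 ∨ ((r, c.2) ∈ S ∧ Sec r T c.2 ∧ NZ r T c.2))
  else false

def Hd (r : ℕ) (T : ℕ × ℕ → Bool) (p : ℕ) : Prop :=
  T (r, p) = true ∧ ∀ j, j < p → T (r, j) = false

def ZZ (r : ℕ) (T : ℕ × ℕ → Bool) (j : ℕ) : Prop :=
  T (r, j) = true ∧ (∃ p, p < j ∧ T (r, p) = true) ∧ ¬ NZ r T j

open Classical in
noncomputable def bwd (S : Finset (ℕ × ℕ)) (r : ℕ) (T : ℕ × ℕ → Bool) (c : ℕ × ℕ) : Bool :=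
  if c.1 < r then decide (T c = true ∨ (ZZ r T c.2 ∧ ∃ p, Hd r T p ∧ T (c.1, p) = true))
  else if c.1 = r then decide (Hd r T c.2 ∨ ZZ r T c.2 ∨ ((r, c.2) ∈ S ∧ ∃ p, Hd r T p ∧
    (∀ i, i < r → T (i, p) = true → T (i, c.2) = true) ∧
    ∃ i, i < r ∧ T (i, p) = false ∧ T (i, c.2) = true))
  else false

theorem fwd_top {S : Finset (ℕ × ℕ)} {r : ℕ} {T : ℕ × ℕ → Bool} {i j : ℕ} (h : i < r) :
    fwd S r T (i, j) = true ↔ T (i, j) = true ∧ ¬ (InN r T j ∧ Sec r T j) := by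
  simp [fwd, h]

theorem fwd_bot {S : Finset (ℕ × ℕ)} {r : ℕ} {T : ℕ × ℕ → Bool} {j : ℕ} :
    fwd S r T (r, j) = true ↔ InN r T j ∨ ((r, j) ∈ S ∧ Sec r T j ∧ NZ r T j) := by
  simp [fwd]

theorem bwd_top {S : Finset (ℕ × ℕ)} {r : ℕ} {T : ℕ × ℕ → Bool} {i j : ℕ} (h : i < r) :
    bwd S r T (i, j) = true ↔ T (i, j) = true ∨ (ZZ r T j ∧ ∃ p, Hd r T p ∧ T (i, p) = true) := by
  simp [bwd, h]

theorem bwd_bot {S : Finset (ℕ × ℕ)} {r : ℕ} {T : ℕ × ℕ → Bool} {j : ℕ} :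
    bwd S r T (r, j) = true ↔ Hd r T j ∨ ZZ r T j ∨ ((r, j) ∈ S ∧ ∃ p, Hd r T p ∧
    (∀ i, i < r → T (i, p) = true → T (i, j) = true) ∧
    ∃ i, i < r ∧ T (i, p) = false ∧ T (i, j) = true) := by
  simp [bwd]

/-- Symmetric form of X-avoidance in rows `≤ n`. -/
def XX (S : Finset (ℕ × ℕ)) (n : ℕ) (T : ℕ × ℕ → Bool) : Prop :=
  ∀ i i' j j', i < i' → i' < n → (i', j) ∈ S → (i', j') ∈ S →
    T (i, j) = true → T (i, j') = false → T (i', j) = false → T (i', j') = true → False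

structure Shape (S : Finset (ℕ × ℕ)) (r : ℕ) : Prop where
  le : ∀ i j, (i, j) ∈ S → i ≤ r
  up : ∀ i i' j, i ≤ i' → (i', j) ∈ S → (i, j) ∈ S

theorem avoidsX_iff {S S' : Finset (ℕ × ℕ)} {r n : ℕ} (hS : Shape S r) (T : ℕ × ℕ → Bool)
    (hS' : ∀ i j, (i, j) ∈ S' ↔ (i, j) ∈ S ∧ i < n) :
    (Avoids S' T true false false true ∧ Avoids S' T false true true false) ↔ XX S n T := by
  have hup := hS.up
  constructor
  · rintro ⟨h1, h2⟩ i i' j j' hi hn hj hj' a b c d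
    rcases lt_trichotomy j j' with h | h | h
    · exact h1 ⟨i, i', j, j', hi, h, by grind, by grind, by grind, by grind, a, b, c, d⟩
    · subst h; simp_all
    · exact h2 ⟨i, i', j', j, hi, h, by grind, by grind, by grind, by grind, b, a, d, c⟩
  · intro h
    constructor
    · rintro ⟨i, i', j, j', hi, hj, c1, c2, c3, c4, a, b, c, d⟩
      exact h i i' j j' hi ((hS' _ _).1 c3).2 ((hS' _ _).1 c3).1 ((hS' _ _).1 c4).1 a b c d
    · rintro ⟨i, i', j, j', hi, hj, c1, c2, c3, c4, a, b, c, d⟩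
      exact h i i' j' j hi ((hS' _ _).1 c3).2 ((hS' _ _).1 c4).1 ((hS' _ _).1 c3).1 b a d c

/-- full columns form a chain -/
theorem chain {S : Finset (ℕ × ℕ)} {r : ℕ} (hS : Shape S r) {T : ℕ × ℕ → Bool}
    (hX : XX S r T) {j j' : ℕ} (hj : (r, j) ∈ S) (hj' : (r, j') ∈ S) :
    (∀ i, i < r → T (i, j) = true → T (i, j') = true) ∨
    (∀ i, i < r → T (i, j') = true → T (i, j) = true) := by
  by_contra! h
  obtain ⟨⟨a, ha, ha1, ha2⟩, b, hb, hb1, hb2⟩ := h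
  have hup := hS.up
  rcases lt_trichotomy a b with h | h | h
  · exact hX a b j j' h hb (hup _ _ _ hb.le hj) (hup _ _ _ hb.le hj') ha1 (by simpa using ha2)
      (by simpa using hb2) hb1
  · subst h; simp_all
  · exact hX b a j' j h ha (hup _ _ _ ha.le hj') (hup _ _ _ ha.le hj) hb1 (by simpa using hb2)
      (by simpa using ha2) ha1

theorem exists_InN {S : Finset (ℕ × ℕ)} {r : ℕ} (hS : Shape S r) {T : ℕ × ℕ → Bool}
    (hF : IsFilling S T) (hX : XX S r T) {j : ℕ} (hj : T (r, j) = true) :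
    ∃ p, InN r T p := by
  let f : ℕ → ℕ := fun j => ((Finset.range r).filter (fun i => T (i, j) = true)).card
  have hex : ∃ n, ∃ p, T (r, p) = true ∧ f p = n := ⟨_, j, hj, rfl⟩
  classical
  obtain ⟨p, hp, hpn⟩ := Nat.find_spec hex
  have cell : ∀ j, T (r, j) = true → (r, j) ∈ S := by
    intro j h; by_contra hc; simp [hF _ hc] at h
  refine ⟨p, hp, fun j' hj' => ?_⟩
  rcases chain hS hX (cell _ hp) (cell _ hj') with h | h
  · exact h
  · have hmin : f p ≤ f j' := by
      rw [hpn]; exact Nat.find_min' hex ⟨j', hj', rfl⟩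
    have hsub : (Finset.range r).filter (fun i => T (i, j') = true) ⊆
        (Finset.range r).filter (fun i => T (i, p) = true) := by
      intro i hi
      simp only [Finset.mem_filter, Finset.mem_range] at hi ⊢
      exact ⟨hi.1, h i hi.1 hi.2⟩
    have heq := Finset.eq_of_subset_of_card_le hsub hmin
    intro i hi hip
    have : i ∈ (Finset.range r).filter (fun i => T (i, p) = true) := by simp [hi, hip]
    rw [← heq] at this
    exact (Finset.mem_filter.1 this).2

theorem least {P : ℕ → Prop} {j : ℕ} (h : P j) : ∃ p, P p ∧ p ≤ j ∧ ∀ q, q < p → ¬ P q := by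
  classical
  exact ⟨Nat.find ⟨j, h⟩, Nat.find_spec ⟨j, h⟩, Nat.find_min' _ h, fun q hq => Nat.find_min _ hq⟩

def MX (S : Finset (ℕ × ℕ)) (r : ℕ) (T : ℕ × ℕ → Bool) : Prop :=
  IsFilling S T ∧ XX S r T ∧ ∀ j, (r, j) ∈ S → T (r, j) = false → NZ r T j →
    ∀ j', j' < j → T (r, j') = false

section main
variable {S : Finset (ℕ × ℕ)} {r : ℕ} (hS : Shape S r) {T : ℕ × ℕ → Bool}

theorem cell_of (hF : IsFilling S T) {c : ℕ × ℕ} (h : T c = true) : c ∈ S := by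
  by_contra hc; simp [hF _ hc] at h

theorem XX_mono (h : XX S (r+1) T) : XX S r T :=
  fun i i' j j' a b => h i i' j j' a (by omega)

theorem fwd_MX (hF : IsFilling S T) (hX : XX S (r+1) T) : MX S r (fwd S r T) := by
  refine ⟨?_, ?_, ?_⟩
  · rintro ⟨i, j⟩ hc
    by_contra h
    rw [Bool.not_eq_false] at h
    rcases lt_trichotomy i r with hi | hi | hi
    · rw [fwd_top hi] at h
      exact hc (cell_of hF h.1)
    · subst hi
      rw [fwd_bot] at h
      rcases h with h | h
      · exact hc (cell_of hF h.1)
      · exact hc h.1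
    · simp [fwd, show ¬ i < r by omega, show ¬ i = r by omega] at h
  · intro i i' j j' hi hn cj cj' a b c d
    rw [fwd_top (by omega)] at a d
    rw [← Bool.not_eq_true, fwd_top (by omega)] at b c
    exact hX i i' j j' hi (by omega) cj cj' a.1 (by grind) (by grind) d.1
  · intro j cj h0 hnz j' hj'
    rw [← Bool.not_eq_true, fwd_bot] at h0 ⊢
    intro h1
    apply h0
    right
    obtain ⟨i, hi, hi'⟩ := hnz
    rw [fwd_top hi] at hi'
    refine ⟨cj, ?_, i, hi, hi'.1⟩
    rcases h1 with h1 | ⟨_, ⟨p, hp, hp'⟩, _⟩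
    · exact ⟨j', hj', h1⟩
    · exact ⟨p, by omega, hp'⟩

theorem Hd_unique {p q : ℕ} (hp : Hd r T p) (hq : Hd r T q) : p = q := by
  obtain ⟨a, b⟩ := hp
  obtain ⟨c, d⟩ := hq
  rcases lt_trichotomy p q with h | h | h
  · simp [d _ h] at a
  · exact h
  · simp [b _ h] at c

include hS

theorem bwd_X (hM : MX S r T) : IsFilling S (bwd S r T) ∧ XX S (r+1) (bwd S r T) := by
  obtain ⟨hF, hX, hm⟩ := hM
  constructor
  · rintro ⟨i, j⟩ hc
    by_contra h
    rw [Bool.not_eq_false] at h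
    rcases lt_trichotomy i r with hi | hi | hi
    · rw [bwd_top hi] at h
      rcases h with h | h
      · exact hc (cell_of hF h)
      · exact hc (hS.up _ _ _ hi.le (cell_of hF h.1.1))
    · subst hi
      rw [bwd_bot] at h
      rcases h with h | h | h
      · exact hc (cell_of hF h.1)
      · exact hc (cell_of hF h.1)
      · exact hc h.1
    · simp [bwd, show ¬ i < r by omega, show ¬ i = r by omega] at h
  · -- every column of the new top part is a column of the old one
    have sig : ∀ j, ∃ s, (s = j ∨ (r, s) ∈ S) ∧ (∀ i, i < r → (bwd S r T (i, j) = T (i, s))) ∧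
        (¬ ZZ r T j → s = j) ∧ (ZZ r T j → Hd r T s) := by
      intro j
      by_cases hz : ZZ r T j
      · obtain ⟨p, hp, _, hmin⟩ := least (P := fun p => T (r, p) = true) hz.1
        have hd : Hd r T p := ⟨hp, fun q hq => by simpa using hmin q hq⟩
        refine ⟨p, Or.inr (cell_of hF hp), ?_, fun h => absurd hz h, fun _ => hd⟩
        intro i hi
        rw [Bool.eq_iff_iff, bwd_top hi]
        constructor
        · rintro (h | ⟨_, q, hq, hq'⟩)
          · exact absurd ⟨i, hi, h⟩ hz.2.2
          · rwa [Hd_unique hd hq]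
        · exact fun h => Or.inr ⟨hz, p, hd, h⟩
      · refine ⟨j, Or.inl rfl, ?_, fun _ => rfl, fun h => absurd h hz⟩
        intro i hi
        rw [Bool.eq_iff_iff, bwd_top hi]
        simp [hz]
    intro i i' j j' hi hn cj cj' a b c d
    obtain ⟨s, hs, hs1, hs2, hs3⟩ := sig j
    obtain ⟨s', hs', hs1', hs2', hs3'⟩ := sig j'
    rcases Nat.lt_or_ge i' r with hr | hr
    · rw [hs1 _ (by omega)] at a c
      rw [hs1' _ (by omega)] at b d
      refine hX i i' s s' hi hr ?_ ?_ a b c d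
      · rcases hs with h | h
        · rwa [h]
        · exact hS.up _ _ _ hr.le h
      · rcases hs' with h | h
        · rwa [h]
        · exact hS.up _ _ _ hr.le h
    · obtain rfl : i' = r := by omega
      rw [hs1 _ (by omega)] at a
      rw [hs1' _ (by omega)] at b
      rw [← Bool.not_eq_true, bwd_bot] at c
      rw [bwd_bot] at d
      push Not at c
      obtain ⟨c1, c2, c3⟩ := c
      have hsj := hs2 c2
      subst hsj
      have key : ∃ p, Hd i' T p ∧ (∀ i, i < i' → T (i, p) = true → T (i, s') = true) := by
        rcases d with d | d | ⟨_, p, hp, hp', _⟩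
        · have : ¬ ZZ i' T j' := by
            rintro ⟨_, ⟨q, hq, hq'⟩, _⟩
            simp [d.2 q hq] at hq'
          rw [hs2' this]
          exact ⟨j', d, fun _ _ h => h⟩
        · exact ⟨s', hs3' d, fun _ _ h => h⟩
        · by_cases hz : ZZ i' T j'
          · exact ⟨s', hs3' hz, fun _ _ h => h⟩
          · rw [hs2' hz]; exact ⟨p, hp, hp'⟩
      obtain ⟨p, hp, hps⟩ := key
      have hle : ∀ i, i < i' → T (i, s) = true → T (i, p) = true := by
        rcases chain hS hX cj (cell_of hF hp.1) with h | h
        · exact h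
        · intro k hk hk'
          by_contra hne
          exact c3 cj p hp h k hk (by simpa using hne) hk'
      have := hps i hi (hle i hi a)
      simp [this] at b

theorem bwd_fwd (hF : IsFilling S T) (hX : XX S (r+1) T) : bwd S r (fwd S r T) = T := by
  have hX' := XX_mono hX
  -- the first 1 of the new bottom row
  have hH : ∀ p, Hd r (fwd S r T) p ↔ InN r T p ∧ ¬ Sec r T p := by
    intro p
    constructor
    · rintro ⟨h1, h2⟩
      have hs : ¬ Sec r T p := by
        rintro ⟨q, hq, hq'⟩
        have := h2 q hq
        rw [← Bool.not_eq_true, fwd_bot] at this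
        exact this (Or.inl hq')
      rw [fwd_bot] at h1
      exact ⟨by tauto, hs⟩
    · rintro ⟨h1, h2⟩
      refine ⟨fwd_bot.2 (Or.inl h1), fun j hj => ?_⟩
      rw [← Bool.not_eq_true, fwd_bot]
      rintro (h | ⟨_, ⟨q, hq, hq'⟩, _⟩)
      · exact h2 ⟨j, hj, h⟩
      · exact h2 ⟨q, by omega, hq'⟩
  have hZ : ∀ j, ZZ r (fwd S r T) j ↔ InN r T j ∧ Sec r T j := by
    intro j
    constructor
    · rintro ⟨h1, ⟨p, hp, hp'⟩, h3⟩
      rw [fwd_bot] at h1 hp'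
      have hs : Sec r T j := by
        rcases hp' with h | ⟨_, ⟨q, hq, hq'⟩, _⟩
        · exact ⟨p, hp, h⟩
        · exact ⟨q, by omega, hq'⟩
      refine ⟨?_, hs⟩
      by_contra hn
      rcases h1 with h1 | ⟨_, _, i, hi, hi'⟩
      · exact hn h1
      · exact h3 ⟨i, hi, (fwd_top hi).2 ⟨hi', fun h => hn h.1⟩⟩
    · rintro ⟨h1, p, hp, hp'⟩
      refine ⟨fwd_bot.2 (Or.inl h1), ⟨p, hp, fwd_bot.2 (Or.inl hp')⟩, ?_⟩
      rintro ⟨i, hi, hi'⟩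
      exact ((fwd_top hi).1 hi').2 ⟨h1, p, hp, hp'⟩
  have hfirst : ∀ j, InN r T j → ∃ p, InN r T p ∧ ¬ Sec r T p := by
    intro j hj
    obtain ⟨p, hp, _, hmin⟩ := least (P := InN r T) hj
    exact ⟨p, hp, fun ⟨q, hq, hq'⟩ => hmin q hq hq'⟩
  funext ⟨i, j⟩
  rw [Bool.eq_iff_iff]
  rcases lt_trichotomy i r with hi | hi | hi
  · rw [bwd_top hi, hZ, fwd_top hi]
    constructor
    · rintro (h | ⟨⟨h1, _⟩, p, hp, hp'⟩)
      · exact h.1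
      · rw [hH] at hp
        rw [fwd_top hi] at hp'
        exact hp.1.2 j h1.1 i hi hp'.1
    · intro h
      by_cases hz : InN r T j ∧ Sec r T j
      · right
        obtain ⟨p, hp⟩ := hfirst j hz.1
        exact ⟨hz, p, (hH p).2 hp, (fwd_top hi).2 ⟨hz.1.2 p hp.1.1 i hi h, fun h => hp.2 h.2⟩⟩
      · exact Or.inl ⟨h, hz⟩
  · subst hi
    rw [bwd_bot, hH, hZ]
    constructor
    · rintro (h | h | ⟨hc, p, hp, h1, k, hk, hk1, hk2⟩)
      · exact h.1.1
      · exact h.1.1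
      · rw [hH] at hp
        rw [fwd_top hk] at hk2
        rw [← Bool.not_eq_true, fwd_top hk] at hk1
        by_contra hne
        refine hX k i j p hk (by omega) hc (cell_of hF hp.1.1) hk2.1 ?_ (by simpa using hne) hp.1.1
        by_contra h
        exact hk1 ⟨by simpa using h, fun h => hp.2 h.2⟩
    · intro h
      by_cases hn : InN i T j
      · by_cases hs : Sec i T j
        · exact Or.inr (Or.inl ⟨hn, hs⟩)
        · exact Or.inl ⟨hn, hs⟩
      · right; right
        obtain ⟨q, hq⟩ := exists_InN hS hF hX' h
        obtain ⟨p, hp⟩ := hfirst q hq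
        refine ⟨cell_of hF h, p, (hH p).2 hp, ?_, ?_⟩
        · intro k hk hk'
          rw [fwd_top hk] at hk' ⊢
          exact ⟨hp.1.2 j h k hk hk'.1, fun h => hn h.1⟩
        · by_contra! hne
          apply hn
          refine ⟨h, fun j' hj' k hk hk' => hp.1.2 j' hj' k hk ?_⟩
          by_contra hkp
          refine hne k hk ?_ ((fwd_top hk).2 ⟨hk', fun h => hn h.1⟩)
          rw [← Bool.not_eq_true, fwd_top hk]
          exact fun h => hkp h.1
  · have : (i, j) ∉ S := fun h => by have := hS.le _ _ h; omega
    rw [hF _ this]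
    simp [bwd, show ¬ i < r by omega, show ¬ i = r by omega]

theorem fwd_bwd (hM : MX S r T) : fwd S r (bwd S r T) = T := by
  obtain ⟨hF, hX, hm⟩ := hM
  have hHex : ∀ j, T (r, j) = true → ∃ p, Hd r T p ∧ p ≤ j := by
    intro j hj
    obtain ⟨p, hp, hle, hmin⟩ := least (P := fun p => T (r, p) = true) hj
    exact ⟨p, ⟨hp, fun q hq => by simpa using hmin q hq⟩, hle⟩
  have hHZ : ∀ j, Hd r T j → ¬ ZZ r T j := by
    rintro j ⟨_, h⟩ ⟨_, ⟨q, hq, hq'⟩, _⟩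
    simp [h q hq] at hq'
  have hN : ∀ j, InN r (bwd S r T) j ↔ Hd r T j ∨ ZZ r T j := by
    intro j
    constructor
    · rintro ⟨h1, h2⟩
      rw [bwd_bot] at h1
      by_contra! hn
      rcases h1 with h1 | h1 | ⟨hc, p, hp, h3, i, hi, hi1, hi2⟩
      · exact hn.1 h1
      · exact hn.2 h1
      · have := h2 p (bwd_bot.2 (Or.inl hp)) i hi ((bwd_top hi).2 (Or.inl hi2))
        rw [bwd_top hi] at this
        rcases this with h | h
        · simp [hi1] at h
        · exact hHZ p hp h.1
    · intro h
      have hb : bwd S r T (r, j) = true := bwd_bot.2 (by tauto)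
      refine ⟨hb, fun j' hj' i hi hi' => ?_⟩
      have hp : ∃ p, Hd r T p ∧ T (i, p) = true := by
        rw [bwd_top hi] at hi'
        rcases h with h | h
        · rcases hi' with hi' | hi'
          · exact ⟨j, h, hi'⟩
          · exact hi'.2
        · rcases hi' with hi' | hi'
          · exact absurd ⟨i, hi, hi'⟩ h.2.2
          · exact hi'.2
      obtain ⟨p, hp, hpi⟩ := hp
      rw [bwd_top hi]
      rw [bwd_bot] at hj'
      rcases hj' with hj' | hj' | ⟨_, q, hq, hq', _⟩
      · left; rwa [Hd_unique hj' hp]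
      · exact Or.inr ⟨hj', p, hp, hpi⟩
      · left; apply hq' i hi; rwa [Hd_unique hq hp]
  have hS' : ∀ j, Sec r (bwd S r T) j ↔ ∃ p, p < j ∧ Hd r T p := by
    intro j
    constructor
    · rintro ⟨q, hq, hq'⟩
      rw [hN] at hq'
      rcases hq' with h | h
      · exact ⟨q, hq, h⟩
      · obtain ⟨p, hp, hle⟩ := hHex q h.1
        exact ⟨p, by omega, hp⟩
    · rintro ⟨p, hp, hp'⟩
      exact ⟨p, hp, (hN p).2 (Or.inl hp')⟩
  have hZS : ∀ j, ZZ r T j → ∃ p, p < j ∧ Hd r T p := by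
    rintro j ⟨_, ⟨q, hq, hq'⟩, _⟩
    obtain ⟨p, hp, hle⟩ := hHex q hq'
    exact ⟨p, by omega, hp⟩
  funext ⟨i, j⟩
  rw [Bool.eq_iff_iff]
  rcases lt_trichotomy i r with hi | hi | hi
  · rw [fwd_top hi, hN, hS', bwd_top hi]
    constructor
    · rintro ⟨h1, h2⟩
      rcases h1 with h1 | h1
      · exact h1
      · exact absurd ⟨Or.inr h1.1, hZS j h1.1⟩ h2
    · intro h
      refine ⟨Or.inl h, ?_⟩
      rintro ⟨h1 | h1, p, hp, hp'⟩
      · have := Hd_unique h1 hp'; omega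
      · exact h1.2.2 ⟨i, hi, h⟩
  · subst hi
    rw [fwd_bot, hN, hS']
    constructor
    · rintro ((h | h) | ⟨hc, ⟨p, hp, hp'⟩, k, hk, hk'⟩)
      · exact h.1
      · exact h.1
      · by_contra hne
        rw [bwd_top hk] at hk'
        rcases hk' with hk' | hk'
        · have := hm j hc (by simpa using hne) ⟨k, hk, hk'⟩ p hp
          simp [hp'.1] at this
        · exact hne hk'.1.1
    · intro h
      obtain ⟨p, hp, hle⟩ := hHex j h
      rcases Nat.lt_or_ge p j with hlt | hge
      · by_cases hnz : NZ i T j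
        · obtain ⟨k, hk, hk'⟩ := hnz
          exact Or.inr ⟨cell_of hF h, ⟨p, hlt, hp⟩, k, hk, (bwd_top hk).2 (Or.inl hk')⟩
        · exact Or.inl (Or.inr ⟨h, ⟨p, hlt, hp.1⟩, hnz⟩)
      · obtain rfl : p = j := by omega
        exact Or.inl (Or.inl hp)
  · have : (i, j) ∉ S := fun h => by have := hS.le _ _ h; omega
    rw [hF _ this]
    simp [fwd, show ¬ i < r by omega, show ¬ i = r by omega]

theorem zero_row (hF : IsFilling S T) (hX : XX S (r+1) T) (i : ℕ) :
    (∃ j, T (i, j) = true) ↔ ∃ j, fwd S r T (i, j) = true := by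
  rcases lt_trichotomy i r with hi | hi | hi
  · constructor
    · rintro ⟨j, hj⟩
      by_cases h : InN r T j ∧ Sec r T j
      · obtain ⟨p, hp, _, hmin⟩ := least (P := InN r T) h.1
        exact ⟨p, (fwd_top hi).2 ⟨h.1.2 p hp.1 i hi hj, fun ⟨_, q, hq, hq'⟩ => hmin q hq hq'⟩⟩
      · exact ⟨j, (fwd_top hi).2 ⟨hj, h⟩⟩
    · rintro ⟨j, hj⟩
      exact ⟨j, ((fwd_top hi).1 hj).1⟩
  · subst hi
    constructor
    · rintro ⟨j, hj⟩
      obtain ⟨p, hp⟩ := exists_InN hS hF (XX_mono hX) hj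
      exact ⟨p, fwd_bot.2 (Or.inl hp)⟩
    · rintro ⟨j, hj⟩
      rcases fwd_bot.1 hj with h | ⟨_, ⟨p, _, hp⟩, _⟩
      · exact ⟨j, h.1⟩
      · exact ⟨p, hp.1⟩
  · have h1 : ∀ j, T (i, j) = false := fun j => hF _ fun h => by have := hS.le _ _ h; omega
    simp [h1, fwd, show ¬ i < r by omega, show ¬ i = r by omega]

theorem zero_col (hF : IsFilling S T) (j : ℕ) :
    (∃ i, T (i, j) = true) ↔ ∃ i, fwd S r T (i, j) = true := by
  constructor
  · rintro ⟨i, hi⟩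
    by_cases hn : InN r T j
    · exact ⟨r, fwd_bot.2 (Or.inl hn)⟩
    · have hle := hS.le _ _ (cell_of hF hi)
      rcases Nat.lt_or_ge i r with h | h
      · exact ⟨i, (fwd_top h).2 ⟨hi, fun h => hn h.1⟩⟩
      · obtain rfl : i = r := by omega
        by_contra! hne
        refine hn ⟨hi, fun j' _ k hk hk' => ?_⟩
        exact absurd ((fwd_top hk).2 ⟨hk', fun h => hn h.1⟩) (hne k)
  · rintro ⟨i, hi⟩
    rcases lt_trichotomy i r with h | h | h
    · exact ⟨i, ((fwd_top h).1 hi).1⟩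
    · subst h
      rcases fwd_bot.1 hi with h | ⟨_, _, k, _, hk⟩
      · exact ⟨_, h.1⟩
      · exact ⟨k, hk⟩
    · simp [fwd, show ¬ i < r by omega, show ¬ i = r by omega] at hi

end main

theorem X_iff {S : Finset (ℕ × ℕ)} {r : ℕ} (hS : Shape S r) (T : ℕ × ℕ → Bool) :
    IsXDiagram S T ↔ IsFilling S T ∧ XX S (r+1) T := by
  unfold IsXDiagram
  rw [avoidsX_iff (n := r+1) hS T]
  intro i j
  have := hS.le i j
  constructor
  · intro h; exact ⟨h, by have := this h; omega⟩
  · exact fun h => h.1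

theorem mixed_iff {S : Finset (ℕ × ℕ)} {k : ℕ} (hS : Shape S (k-1)) (T : ℕ × ℕ → Bool) :
    IsMixed S k T ↔ MX S (k-1) T := by
  unfold IsMixed MX AvoidsX
  rw [avoidsX_iff (n := k-1) hS T]
  · refine and_congr_right fun hF => and_congr_right fun _ => forall_congr' fun j =>
      imp_congr_right fun hc => imp_congr_right fun _ => ?_
    constructor
    · rintro (h | h)
      · rintro ⟨i, hi, hi'⟩
        have := h i (by omega) (cell_of hF hi')
        simp [this] at hi'
      · intro _ j' hj'
        by_contra hne
        have hne : T (k-1, j') = true := by simpa using hne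
        have := h j' hj' (cell_of hF hne)
        simp [this] at hne
    · intro h
      by_cases hn : NZ (k-1) T j
      · exact Or.inr fun j' hj' _ => h hn j' hj'
      · left
        intro i hi _
        by_contra hne
        exact hn ⟨i, by omega, by simpa using hne⟩
  · intro i j
    simp only [Finset.mem_filter]
    refine and_congr_right fun _ => ?_
    omega

theorem zrow_iff {S : Finset (ℕ × ℕ)} {T : ℕ × ℕ → Bool} (hF : IsFilling S T) (i : ℕ) :
    ZeroRow S T i ↔ ¬ ∃ j, T (i, j) = true := by
  constructor
  · rintro h ⟨j, hj⟩
    simp [h j (cell_of hF hj)] at hj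
  · intro h j _
    by_contra hne
    exact h ⟨j, by simpa using hne⟩

theorem zcol_iff {S : Finset (ℕ × ℕ)} {T : ℕ × ℕ → Bool} (hF : IsFilling S T) (j : ℕ) :
    ZeroCol S T j ↔ ¬ ∃ i, T (i, j) = true := by
  constructor
  · rintro h ⟨i, hi⟩
    simp [h i (cell_of hF hi)] at hi
  · intro h i _
    by_contra hne
    exact h ⟨i, by simpa using hne⟩

/-- there is a bijection between X-diagrams and mixed diagrams of
a given Young-diagram shape (with `k = μ.colLen 0` rows) preserving the set of
zero-rows and of zero-columns. -/
theorem stmt2 (μ : YoungDiagram) :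
    ∃ φ : {T : ℕ × ℕ → Bool // IsXDiagram μ.cells T} ≃
          {T : ℕ × ℕ → Bool // IsMixed μ.cells (μ.colLen 0) T},
      ∀ T : {T : ℕ × ℕ → Bool // IsXDiagram μ.cells T},
        (∀ i, ZeroRow μ.cells T.1 i ↔ ZeroRow μ.cells (φ T).1 i) ∧
        (∀ j, ZeroCol μ.cells T.1 j ↔ ZeroCol μ.cells (φ T).1 j) := by
  have hS : Shape μ.cells (μ.colLen 0 - 1) := by
    constructor
    · intro i j h
      have h0 : (i, 0) ∈ μ := μ.up_left_mem le_rfl (Nat.zero_le j) ((YoungDiagram.mem_cells _).1 h)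
      rw [YoungDiagram.mem_iff_lt_colLen] at h0
      omega
    · intro i i' j hi h
      exact (YoungDiagram.mem_cells _).2 (μ.up_left_mem hi le_rfl ((YoungDiagram.mem_cells _).1 h))
  refine ⟨⟨fun T => ⟨fwd μ.cells (μ.colLen 0 - 1) T.1, ?_⟩,
    fun T => ⟨bwd μ.cells (μ.colLen 0 - 1) T.1, ?_⟩, ?_, ?_⟩, ?_⟩
  · obtain ⟨h1, h2⟩ := (X_iff hS T.1).1 T.2
    exact (mixed_iff hS _).2 (fwd_MX h1 h2)
  · exact (X_iff hS _).2 (bwd_X hS ((mixed_iff hS _).1 T.2))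
  · intro T
    obtain ⟨h1, h2⟩ := (X_iff hS T.1).1 T.2
    exact Subtype.ext (bwd_fwd hS h1 h2)
  · intro T
    exact Subtype.ext (fwd_bwd hS ((mixed_iff hS _).1 T.2))
  · intro T
    obtain ⟨h1, h2⟩ := (X_iff hS T.1).1 T.2
    have h3 := (fwd_MX h1 h2).1
    refine ⟨fun i => ?_, fun j => ?_⟩
    · rw [zrow_iff h1, zero_row hS h1 h2 i]
      exact (zrow_iff h3 i).symm
    · rw [zcol_iff h1, zero_col hS h1 j]
      exact (zcol_iff h3 j).symm
end

section
/- Let T be a diagram whose shape is a Young diagram λ. The following conditions are equivalent: (1) T is an X-diagram; (2) for every rectangular submatrix M of T, any two rows of M containing the same number of 1s are equal; (3) for every rectangular submatrix of T having two rows, the set of column positions of the 1s in the first row contains, or is contained in, the set of column positions of the 1s in the second row; (4) for every rectangular submatrix M of T, every entry of M equal to 0 that lies in a row of M having a maximal number of 1s belongs to a column of M all of whose entries are 0. -/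
/-- characterizations of X-diagrams via rectangular submatrices.
A rectangular submatrix is given by strictly increasing rows `r : Fin p → ℕ`
and columns `c : Fin q → ℕ` with all pairs `(r a, c b)` cells of the shape. -/
theorem stmt3 (μ : YoungDiagram) (T : ℕ × ℕ → Bool) (hT : IsFilling μ.cells T) :
    List.TFAE [
      -- (1) T is an X-diagram
      IsXDiagram μ.cells T,
      -- (2) in every rectangular submatrix, two rows with the same number of 1s are equal
      ∀ (p q : ℕ) (r : Fin p → ℕ) (c : Fin q → ℕ), StrictMono r → StrictMono c →
        (∀ a b, (r a, c b) ∈ μ.cells) →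
        ∀ a a' : Fin p,
          (Finset.univ.filter fun b => T (r a, c b) = true).card
            = (Finset.univ.filter fun b => T (r a', c b) = true).card →
          ∀ b, T (r a, c b) = T (r a', c b),
      -- (3) in every two-row rectangular submatrix, the index set of 1s of one
      -- row contains that of the other
      ∀ (q : ℕ) (i i' : ℕ) (c : Fin q → ℕ), i < i' → StrictMono c →
        (∀ b, (i, c b) ∈ μ.cells) → (∀ b, (i', c b) ∈ μ.cells) →
        (∀ b, T (i, c b) = true → T (i', c b) = true) ∨
        (∀ b, T (i', c b) = true → T (i, c b) = true),
      -- (4) in every rectangular submatrix, a 0 in a row with maximal number of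
      -- 1s lies in a zero-column of the submatrix
      ∀ (p q : ℕ) (r : Fin p → ℕ) (c : Fin q → ℕ), StrictMono r → StrictMono c →
        (∀ a b, (r a, c b) ∈ μ.cells) →
        ∀ (a : Fin p) (b : Fin q), T (r a, c b) = false →
          (∀ a' : Fin p,
            (Finset.univ.filter fun b' => T (r a', c b') = true).card
              ≤ (Finset.univ.filter fun b' => T (r a, c b') = true).card) →
          ∀ a' : Fin p, T (r a', c b) = false ] := by
  have sm : ∀ x y : ℕ, x < y → StrictMono (![x, y] : Fin 2 → ℕ) := by
    intro x y h a b hab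
    fin_cases a <;> fin_cases b <;> simp_all
  have sub : ∀ (q : ℕ) (f g : Fin q → Bool),
      ((∀ b, f b = true → g b = true) ∨ (∀ b, g b = true → f b = true)) →
      (Finset.univ.filter fun b => g b = true).card
        ≤ (Finset.univ.filter fun b => f b = true).card →
      ∀ b, g b = true → f b = true := by
    intro q f g h hc
    rcases h with h | h
    · have hs : (Finset.univ.filter fun b => f b = true) ⊆
          (Finset.univ.filter fun b => g b = true) := by
        intro b hb
        simp only [Finset.mem_filter, Finset.mem_univ, true_and] at hb ⊢
        exact h b hb
      have he := Finset.eq_of_subset_of_card_le hs hc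
      intro b hb
      have : b ∈ (Finset.univ.filter fun b => f b = true) := by
        rw [he]; simpa using hb
      simpa using this
    · exact h
  tfae_have 1 → 3 := by
    rintro ⟨-, h1, h2⟩ q i i' c hi hc hm hm'
    by_contra hcon
    push Not at hcon
    obtain ⟨⟨b, hb, hb'⟩, ⟨d, hd, hd'⟩⟩ := hcon
    simp only [ne_eq, Bool.not_eq_true] at hb' hd'
    rcases lt_trichotomy (c b) (c d) with h | h | h
    · exact h1 ⟨i, i', c b, c d, hi, h, hm b, hm d, hm' b, hm' d, hb, hd', hb', hd⟩
    · rw [h, hd'] at hb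
      exact absurd hb (by simp)
    · exact h2 ⟨i, i', c d, c b, hi, h, hm d, hm b, hm' d, hm' b, hd', hb, hd, hb'⟩
  have key : (∀ (q : ℕ) (i i' : ℕ) (c : Fin q → ℕ), i < i' → StrictMono c →
        (∀ b, (i, c b) ∈ μ.cells) → (∀ b, (i', c b) ∈ μ.cells) →
        (∀ b, T (i, c b) = true → T (i', c b) = true) ∨
        (∀ b, T (i', c b) = true → T (i, c b) = true)) →
      ∀ (p q : ℕ) (r : Fin p → ℕ) (c : Fin q → ℕ), StrictMono c →
        (∀ a b, (r a, c b) ∈ μ.cells) → ∀ a a' : Fin p,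
        (∀ b, T (r a, c b) = true → T (r a', c b) = true) ∨
        (∀ b, T (r a', c b) = true → T (r a, c b) = true) := by
    intro h p q r c hc hm a a'
    rcases lt_trichotomy (r a) (r a') with hl | hl | hl
    · exact h q _ _ c hl hc (hm a) (hm a')
    · left; intro b hb; rwa [← hl]
    · exact (h q _ _ c hl hc (hm a') (hm a)).symm
  tfae_have 3 → 2 := by
    intro h p q r c hr hc hm a a' he b
    have hk := key h p q r c hc hm a a'
    have e1 := sub q (fun b => T (r a, c b)) (fun b => T (r a', c b)) hk he.ge b
    have e2 := sub q (fun b => T (r a', c b)) (fun b => T (r a, c b)) hk.symm he.le b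
    exact Bool.eq_iff_iff.mpr ⟨e2, e1⟩
  tfae_have 3 → 4 := by
    intro h p q r c hr hc hm a b hb hmax a'
    have hk := key h p q r c hc hm a a'
    have e1 := sub q (fun b => T (r a, c b)) (fun b => T (r a', c b)) hk (hmax a') b
    by_contra hcon
    have := e1 (by simpa using hcon)
    simp [hb] at this
  have mem : ∀ i i' j j' : ℕ, (i, j) ∈ μ.cells → (i, j') ∈ μ.cells → (i', j) ∈ μ.cells →
      (i', j') ∈ μ.cells → ∀ a b : Fin 2, ((![i, i'] : Fin 2 → ℕ) a, (![j, j'] : Fin 2 → ℕ) b) ∈ μ.cells := by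
    intro i i' j j' h1 h2 h3 h4 a b
    fin_cases a <;> fin_cases b <;> assumption
  tfae_have 2 → 1 := by
    intro h
    refine ⟨hT, ?_, ?_⟩
    all_goals
      rintro ⟨i, i', j, j', hi, hj, m1, m2, m3, m4, t1, t2, t3, t4⟩
      have := h 2 2 ![i, i'] ![j, j'] (sm _ _ hi) (sm _ _ hj) (mem _ _ _ _ m1 m2 m3 m4) 0 1
        (by (rw [Finset.card_filter, Finset.card_filter, Fin.sum_univ_two, Fin.sum_univ_two]; simp [t1, t2, t3, t4])) 0
      simp [t1, t3] at this
  tfae_have 4 → 1 := by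
    intro h
    refine ⟨hT, ?_, ?_⟩
    · rintro ⟨i, i', j, j', hi, hj, m1, m2, m3, m4, t1, t2, t3, t4⟩
      have := h 2 2 ![i, i'] ![j, j'] (sm _ _ hi) (sm _ _ hj) (mem _ _ _ _ m1 m2 m3 m4) 0 1
        (by simpa using t2)
        (by intro a; fin_cases a <;>
              (rw [Finset.card_filter, Finset.card_filter, Fin.sum_univ_two, Fin.sum_univ_two]; simp [t1, t2, t3, t4])) 1
      simp [t4] at this
    · rintro ⟨i, i', j, j', hi, hj, m1, m2, m3, m4, t1, t2, t3, t4⟩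
      have := h 2 2 ![i, i'] ![j, j'] (sm _ _ hi) (sm _ _ hj) (mem _ _ _ _ m1 m2 m3 m4) 0 0
        (by simpa using t1)
        (by intro a; fin_cases a <;>
              (rw [Finset.card_filter, Finset.card_filter, Fin.sum_univ_two, Fin.sum_univ_two]; simp [t1, t2, t3, t4])) 1
      simp [t3] at this
  tfae_finish
end

section
/- For every X-diagram T of rectangular shape with k rows and m columns, there exist a permutation σ of {1,…,k} and a permutation τ of {1,…,m} such that the rearranged diagram T' defined by T'(i,j) = T(σ(i), τ(j)) has its 1s arranged as a Young diagram: whenever T'(i,j) = 1 and i' ≤ i, j' ≤ j, then T'(i',j') = 1 (so the 1s and the 0s of T' form two complementary Young diagrams). -/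
/-- `T` (a diagram of rectangular shape, `k` rows and `m` columns) avoids the
2×2 pattern `[[a,b],[c,d]]`. -/
def RAvoids {k m : ℕ} (T : Fin k → Fin m → Bool) (a b c d : Bool) : Prop :=
  ¬ ∃ (i i' : Fin k) (j j' : Fin m), i < i' ∧ j < j' ∧
    T i j = a ∧ T i j' = b ∧ T i' j = c ∧ T i' j' = d

/-- A rectangular X-diagram: avoids `[[1,0],[0,1]]` and `[[0,1],[1,0]]`. -/
def RIsX {k m : ℕ} (T : Fin k → Fin m → Bool) : Prop :=
  RAvoids T true false false true ∧ RAvoids T false true true false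

lemma key {k m : ℕ} (T : Fin k → Fin m → Bool) (hT : RIsX T) (i i' : Fin k) (j j' : Fin m)
    (h1 : T i j = true) (h2 : T i j' = false) (h3 : T i' j = false) (h4 : T i' j' = true) :
    False := by
  obtain ⟨ha, hb⟩ := hT
  rcases lt_trichotomy i i' with h | h | h
  · rcases lt_trichotomy j j' with g | g | g
    · exact ha ⟨i, i', j, j', h, g, h1, h2, h3, h4⟩
    · subst g; simp_all
    · exact hb ⟨i, i', j', j, h, g, h2, h1, h4, h3⟩
  · subst h; simp_all
  · rcases lt_trichotomy j j' with g | g | g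
    · exact hb ⟨i', i, j, j', h, g, h3, h4, h1, h2⟩
    · subst g; simp_all
    · exact ha ⟨i', i, j', j, h, g, h4, h3, h2, h1⟩

lemma sort_rows {k m : ℕ} (T : Fin k → Fin m → Bool)
    (hT : ∀ i i' j j', T i j = true → T i j' = false → T i' j = false → T i' j' = true → False) :
    ∃ σ : Equiv.Perm (Fin k), ∀ (i i' : Fin k) (j : Fin m),
      T (σ i) j = true → i' ≤ i → T (σ i') j = true := by
  let f : Fin k → ℕᵒᵈ := fun i => OrderDual.toDual (Finset.univ.filter fun j => T i j = true).card
  refine ⟨Tuple.sort f, fun i i' j h hi => ?_⟩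
  have hm := Tuple.monotone_sort f hi
  have hc : (Finset.univ.filter fun j => T (Tuple.sort f i) j = true).card ≤
    (Finset.univ.filter fun j => T (Tuple.sort f i') j = true).card := hm
  by_contra hn
  have hs : (Finset.univ.filter fun j => T (Tuple.sort f i') j = true) ⊂
      (Finset.univ.filter fun j => T (Tuple.sort f i) j = true) := by
    refine Finset.ssubset_iff_subset_ne.2 ⟨fun j' hj' => ?_, fun he => ?_⟩
    · simp only [Finset.mem_filter, Finset.mem_univ, true_and] at hj' ⊢
      by_contra hq
      exact hT _ _ j j' h (by simpa using hq) (by simpa using hn) hj'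
    · have := Finset.ext_iff.1 he j
      simp only [Finset.mem_filter, Finset.mem_univ, true_and] at this
      exact hn (this.2 h)
  exact absurd (Finset.card_lt_card hs) (not_lt.2 hc)

/-- after suitable permutations of rows and columns, the 1s of a
rectangular X-diagram form a Young diagram (upper-left justified). -/
theorem stmt5 {k m : ℕ} (T : Fin k → Fin m → Bool) (hT : RIsX T) :
    ∃ (σ : Equiv.Perm (Fin k)) (τ : Equiv.Perm (Fin m)),
      ∀ (i i' : Fin k) (j j' : Fin m),
        T (σ i) (τ j) = true → i' ≤ i → j' ≤ j → T (σ i') (τ j') = true := by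
  obtain ⟨σ, hσ⟩ := sort_rows T (key T hT)
  obtain ⟨τ, hτ⟩ := sort_rows (fun j i => T i j)
    (fun j j' i i' h1 h2 h3 h4 => key T hT i i' j j' h1 h3 h2 h4)
  exact ⟨σ, τ, fun i i' j j' h hi hj => hτ j j' _ (hσ i i' _ h hi) hj⟩
end

section
/- Let λ be a Young diagram with k rows, let T be an X-diagram of shape λ whose bottom row is not entirely 0, and let j be the index of the pivot column of T. Then for every column index i with 1 ≤ i < j, the following are equivalent: (a) the k−1 top entries of column i of T contain strictly fewer 0s than the k−1 top entries of column j; (b) T(k,i) = 1. -/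
/-- Number of 0s among the top `k-1` entries of column `j`. -/
def zerosAbove (T : ℕ × ℕ → Bool) (k j : ℕ) : ℕ :=
  ((Finset.range (k - 1)).filter fun i => T (i, j) = false).card

/-- Number of 1s among the top `k-1` entries of column `j`. -/
def onesAbove (T : ℕ × ℕ → Bool) (k j : ℕ) : ℕ :=
  ((Finset.range (k - 1)).filter fun i => T (i, j) = true).card

/-- `j` (0-indexed) is the pivot column of `T` on the Young diagram `μ` with
`k = μ.colLen 0` rows: `j` is among the first `μ.rowLen (k-1)` columns (the
columns of maximal size), has a 1 in bottom position, a maximal number of 0s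
among such columns, and is leftmost with these properties. -/
def IsPivot (μ : YoungDiagram) (T : ℕ × ℕ → Bool) (j : ℕ) : Prop :=
  j < μ.rowLen (μ.colLen 0 - 1) ∧ T (μ.colLen 0 - 1, j) = true ∧
  (∀ j', j' < μ.rowLen (μ.colLen 0 - 1) → T (μ.colLen 0 - 1, j') = true →
    zerosAbove T (μ.colLen 0) j' ≤ zerosAbove T (μ.colLen 0) j) ∧
  (∀ j', j' < μ.rowLen (μ.colLen 0 - 1) → T (μ.colLen 0 - 1, j') = true →
    zerosAbove T (μ.colLen 0) j' = zerosAbove T (μ.colLen 0) j → j ≤ j')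

/-- for a column `i` strictly to the left of the pivot column `j`,
the `k-1` top entries of column `i` contain strictly fewer 0s than those of
column `j` iff the bottom entry of column `i` is a 1. -/
theorem stmt6 (μ : YoungDiagram) (T : ℕ × ℕ → Bool) (hX : IsXDiagram μ.cells T)
    (hne : ∃ j, (μ.colLen 0 - 1, j) ∈ μ.cells ∧ T (μ.colLen 0 - 1, j) = true)
    (j : ℕ) (hj : IsPivot μ T j) (i : ℕ) (hi : i < j) :
    (zerosAbove T (μ.colLen 0) i < zerosAbove T (μ.colLen 0) j ↔
      T (μ.colLen 0 - 1, i) = true) := by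
  obtain ⟨h1, h2, h3, h4⟩ := hj
  constructor
  · intro hlt
    by_contra hT
    have hT' : T (μ.colLen 0 - 1, i) = false := by simpa using hT
    refine absurd hlt (not_lt.mpr ?_)
    unfold zerosAbove
    apply Finset.card_le_card
    intro r hr
    simp only [Finset.mem_filter, Finset.mem_range] at hr ⊢
    refine ⟨hr.1, ?_⟩
    by_contra hri
    have hri' : T (r, i) = true := by simpa using hri
    have hm : (μ.colLen 0 - 1, j) ∈ μ := YoungDiagram.mem_iff_lt_rowLen.mpr h1
    refine hX.2.1 ⟨r, μ.colLen 0 - 1, i, j, hr.1, hi, ?_, ?_, ?_, ?_, hri', hr.2, hT', h2⟩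
    · exact μ.up_left_mem hr.1.le hi.le hm
    · exact μ.up_left_mem hr.1.le le_rfl hm
    · exact μ.up_left_mem le_rfl hi.le hm
    · exact hm
  · intro hT
    have hi' := hi.trans h1
    refine lt_of_le_of_ne (h3 i hi' hT) fun h => ?_
    exact absurd (h4 i hi' hT h) (not_le.mpr hi)
end

section
/- Let λ be a Young diagram with k rows, let T be an X-diagram of shape λ whose bottom row is not entirely 0, and let j be the index of the pivot column of T. Then for every column index i with j < i ≤ λ_k: if the k−1 top entries of column i of T contain strictly more 1s than the k−1 top entries of column j, then T(k,i) = 1; and if they contain strictly fewer 1s than the k−1 top entries of column j, then T(k,i) = 0. -/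
/-- for a column `i` of maximal size strictly to the right of the
pivot column `j`: strictly more 1s above forces a 1 in bottom position, and
strictly fewer 1s above forces a 0 in bottom position. -/
theorem stmt7 (μ : YoungDiagram) (T : ℕ × ℕ → Bool) (hX : IsXDiagram μ.cells T)
    (hne : ∃ j, (μ.colLen 0 - 1, j) ∈ μ.cells ∧ T (μ.colLen 0 - 1, j) = true)
    (j : ℕ) (hj : IsPivot μ T j) (i : ℕ) (hij : j < i)
    (hi : i < μ.rowLen (μ.colLen 0 - 1)) :
    (onesAbove T (μ.colLen 0) j < onesAbove T (μ.colLen 0) i →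
      T (μ.colLen 0 - 1, i) = true) ∧
    (onesAbove T (μ.colLen 0) i < onesAbove T (μ.colLen 0) j →
      T (μ.colLen 0 - 1, i) = false) := by
  have hsum : ∀ c, zerosAbove T (μ.colLen 0) c + onesAbove T (μ.colLen 0) c
      = μ.colLen 0 - 1 := by
    intro c
    have h := Finset.card_filter_add_card_filter_not (s := Finset.range (μ.colLen 0 - 1))
      (fun r => T (r, c) = false)
    simpa [zerosAbove, onesAbove] using h
  obtain ⟨hjr, hjT, hmax, -⟩ := hj
  obtain ⟨-, -, hav⟩ := hX
  constructor
  · intro hlt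
    by_contra hT
    have hT' : T (μ.colLen 0 - 1, i) = false := by simpa using hT
    obtain ⟨r, hr, hr'⟩ := Finset.exists_mem_notMem_of_card_lt_card hlt
    simp only [Finset.mem_filter, Finset.mem_range, not_and, Bool.not_eq_true] at hr hr'
    have hb : (μ.colLen 0 - 1, i) ∈ μ := YoungDiagram.mem_iff_lt_rowLen.2 hi
    refine hav ⟨r, μ.colLen 0 - 1, j, i, hr.1, hij, ?_, ?_, ?_, hb, hr' hr.1, hr.2, hjT, hT'⟩
    · exact μ.up_left_mem hr.1.le hij.le hb
    · exact μ.up_left_mem hr.1.le le_rfl hb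
    · exact μ.up_left_mem le_rfl hij.le hb
  · intro hlt
    by_contra hT
    have h := hmax i hi (by simpa using hT)
    have h1 := hsum i
    have h2 := hsum j
    omega
end

section
/- For every Young diagram λ, the number of Le-diagrams of shape λ equals the number of diagrams of shape λ avoiding the patterns [[0,1],[1,1]] and [[1,1],[1,1]]. -/
/-- The cell `c` has a 1 to its left and a 1 above it. -/
def Lf (T : ℕ × ℕ → Bool) (i j : ℕ) : Prop := ∃ k, k < j ∧ T (i, k) = true

/-- There is a 1 above. -/
def Abv (T : ℕ × ℕ → Bool) (i j : ℕ) : Prop := ∃ k, k < i ∧ T (k, j) = true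

/-- `T` and `T'` agree on the cells that are not forced in `T`. -/
def Agr (T T' : ℕ × ℕ → Bool) : Prop :=
  ∀ i j, ¬ (Lf T i j ∧ Abv T i j) → T' (i, j) = T (i, j)

theorem Agr.lf {T T' : ℕ × ℕ → Bool} (h : Agr T T') (i j : ℕ) : Lf T' i j ↔ Lf T i j := by
  classical
  constructor
  · rintro ⟨k, hk, h1⟩
    by_cases hc : Lf T i k ∧ Abv T i k
    · obtain ⟨⟨l, hl, h2⟩, _⟩ := hc
      exact ⟨l, by omega, h2⟩
    · exact ⟨k, hk, by rw [← h i k hc]; exact h1⟩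
  · intro hL
    have hs := Nat.find_spec hL
    refine ⟨Nat.find hL, hs.1, ?_⟩
    rw [h i _ ?_]
    · exact hs.2
    · rintro ⟨⟨l, hl, h2⟩, _⟩
      exact Nat.find_min hL hl ⟨by omega, h2⟩

theorem Agr.ab {T T' : ℕ × ℕ → Bool} (h : Agr T T') (i j : ℕ) : Abv T' i j ↔ Abv T i j := by
  classical
  constructor
  · rintro ⟨k, hk, h1⟩
    by_cases hc : Lf T k j ∧ Abv T k j
    · obtain ⟨_, ⟨l, hl, h2⟩⟩ := hc
      exact ⟨l, by omega, h2⟩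
    · exact ⟨k, hk, by rw [← h k j hc]; exact h1⟩
  · intro hL
    have hs := Nat.find_spec hL
    refine ⟨Nat.find hL, hs.1, ?_⟩
    rw [h _ j ?_]
    · exact hs.2
    · rintro ⟨_, ⟨l, hl, h2⟩⟩
      exact Nat.find_min hL hl ⟨by omega, h2⟩

theorem avoid_iff (μ : YoungDiagram) (T : ℕ × ℕ → Bool) (d : Bool) :
    (Avoids μ.cells T true true true d ∧ Avoids μ.cells T false true true d) ↔
    ∀ i j, (i, j) ∈ μ.cells → Lf T i j → Abv T i j → T (i, j) = !d := by
  constructor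
  · rintro ⟨h1, h2⟩ i j hm ⟨l, hl, hl'⟩ ⟨k, hk, hk'⟩
    by_contra hne
    have hd : T (i, j) = d := by cases hT : T (i, j) <;> cases d <;> simp_all
    have m1 : (k, l) ∈ μ.cells := μ.up_left_mem hk.le hl.le hm
    have m2 : (k, j) ∈ μ.cells := μ.up_left_mem hk.le le_rfl hm
    have m3 : (i, l) ∈ μ.cells := μ.up_left_mem le_rfl hl.le hm
    cases hv : T (k, l)
    · exact h2 ⟨k, i, l, j, hk, hl, m1, m2, m3, hm, hv, hk', hl', hd⟩
    · exact h1 ⟨k, i, l, j, hk, hl, m1, m2, m3, hm, hv, hk', hl', hd⟩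
  · intro h
    constructor <;>
    · rintro ⟨k, i, l, j, hk, hl, m1, m2, m3, hm, hv, hk', hl', hd⟩
      have := h i j hm ⟨l, hl, hl'⟩ ⟨k, hk, hk'⟩
      rw [hd] at this
      cases d <;> simp at this

open Classical in
/-- Replace the forced cells of `S` by the value `b`. -/
noncomputable def setForced (S : Finset (ℕ × ℕ)) (b : Bool) (T : ℕ × ℕ → Bool) : ℕ × ℕ → Bool :=
  fun c => if c ∈ S ∧ Lf T c.1 c.2 ∧ Abv T c.1 c.2 then b else T c

theorem setForced_agr (S : Finset (ℕ × ℕ)) (b : Bool) (T : ℕ × ℕ → Bool) :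
    Agr T (setForced S b T) := by
  intro i j h
  simp only [setForced]
  rw [if_neg (fun h' => h h'.2)]

/-- Fillings with forced cells all equal to `b`. -/
def Good (S : Finset (ℕ × ℕ)) (b : Bool) (T : ℕ × ℕ → Bool) : Prop :=
  IsFilling S T ∧ ∀ i j, (i, j) ∈ S → Lf T i j → Abv T i j → T (i, j) = b

theorem setForced_good {S : Finset (ℕ × ℕ)} (b : Bool) {T : ℕ × ℕ → Bool} (h : IsFilling S T) :
    Good S b (setForced S b T) := by
  constructor
  · intro c hc
    simp only [setForced]
    rw [if_neg (fun h' => hc h'.1)]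
    exact h c hc
  · intro i j hm hl ha
    rw [(setForced_agr S b T).lf] at hl
    rw [(setForced_agr S b T).ab] at ha
    simp only [setForced]
    rw [if_pos ⟨hm, hl, ha⟩]

theorem setForced_inv {S : Finset (ℕ × ℕ)} {b b' : Bool} {T : ℕ × ℕ → Bool} (h : Good S b T) :
    setForced S b (setForced S b' T) = T := by
  have hA := setForced_agr S b' T
  funext ⟨i, j⟩
  by_cases hc : (i, j) ∈ S ∧ Lf T i j ∧ Abv T i j
  · have : setForced S b (setForced S b' T) (i, j) = b := by
      rw [setForced, if_pos]
      exact ⟨hc.1, (hA.lf i j).2 hc.2.1, (hA.ab i j).2 hc.2.2⟩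
    rw [this, h.2 i j hc.1 hc.2.1 hc.2.2]
  · rw [setForced, if_neg, setForced, if_neg hc]
    rintro ⟨h1, h2, h3⟩
    exact hc ⟨h1, (hA.lf i j).1 h2, (hA.ab i j).1 h3⟩

/-- the number of Le-diagrams of shape `μ` equals the number of
diagrams of shape `μ` avoiding the patterns `[[0,1],[1,1]]` and
`[[1,1],[1,1]]`. -/
theorem stmt11 (μ : YoungDiagram) :
    {T : ℕ × ℕ → Bool | IsLeDiagram μ.cells T}.ncard
  = {T : ℕ × ℕ → Bool | IsFilling μ.cells T ∧
        Avoids μ.cells T false true true true ∧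
        Avoids μ.cells T true true true true}.ncard := by
  have e1 : {T : ℕ × ℕ → Bool | IsLeDiagram μ.cells T} = {T | Good μ.cells true T} := by
    ext T
    simp only [Set.mem_ofPred_eq, IsLeDiagram, Good, avoid_iff, Bool.not_false]
  have e2 : {T : ℕ × ℕ → Bool | IsFilling μ.cells T ∧
        Avoids μ.cells T false true true true ∧
        Avoids μ.cells T true true true true} = {T | Good μ.cells false T} := by
    ext T
    simp only [Set.mem_ofPred_eq, Good]
    rw [and_comm (a := Avoids μ.cells T false true true true), avoid_iff, Bool.not_true]
  rw [e1, e2]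
  refine Set.ncard_congr (fun T _ => setForced μ.cells false T) ?_ ?_ ?_
  · intro T hT
    exact setForced_good false hT.1
  · intro T T' hT hT' h
    have h' := congrArg (setForced μ.cells true) h
    rwa [setForced_inv hT, setForced_inv hT'] at h'
  · intro T hT
    exact ⟨setForced μ.cells true T, setForced_good true hT.1, setForced_inv hT⟩
end
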